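/- arXiv:2006.12050 — 4 statements merged into one kernel-verified Lean document; each statement's English description precedes it below -/
import Mathlib

section
/- Let n ≥ 2 and let (φ_k)_{k ∈ ℤ} be any family, indexed by the integers, of entire functions φ_k : ℂ^{n-1} → ℂ. Then there exists an entire function φ : ℂ^n → ℂ such that φ(k, z₂, …, z_n) = φ_k(z₂, …, z_n) for every k ∈ ℤ and every (z₂, …, z_n) ∈ ℂ^{n-1}. -/
open Filter Metric Set

/-- A series of entire functions on a finite-dimensional space is entire if, on every ball, all but
finitely many of its terms are bounded by those of a fixed summable series. -/
theorem differentiable_tsum_of_eventually_norm_le {ι E : Type*} [NormedAddCommGroup E]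
    [NormedSpace ℂ E] [ProperSpace E] {f : ι → E → ℂ} {u : ι → ℝ} (hu : Summable u)
    (hf : ∀ i, Differentiable ℂ (f i))
    (hfu : ∀ R : ℝ, ∀ᶠ i in cofinite, ∀ x ∈ closedBall (0 : E) R, ‖f i x‖ ≤ u i) :
    Differentiable ℂ fun x => ∑' i, f i x := by
  classical
  intro x
  set R : ℝ := ‖x‖ + 1 with hR
  have hbdd (i : ι) : ∃ C, ∀ y ∈ closedBall (0 : E) (R + 1), ‖f i y‖ ≤ C :=
    (isCompact_closedBall _ _).exists_bound_of_continuousOn (hf i).continuous.continuousOn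
  choose C hC using hbdd
  let v : ι → ℝ := fun i =>
    if ∀ y ∈ closedBall (0 : E) (R + 1), ‖f i y‖ ≤ u i then u i else C i
  have hv : Summable v := hu.congr_cofinite <| by
    filter_upwards [hfu (R + 1)] with i hi
    exact (if_pos hi).symm
  have hfv (i : ι) (y : E) (hy : y ∈ closedBall (0 : E) (R + 1)) : ‖f i y‖ ≤ v i := by
    by_cases h : ∀ y ∈ closedBall (0 : E) (R + 1), ‖f i y‖ ≤ u i
    · simpa only [v, if_pos h] using h y hy
    · simpa only [v, if_neg h] using hC i y hy
  have hx : x ∈ ball (0 : E) R := by simp [hR]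
  have hsub : ball (0 : E) R ⊆ closedBall 0 (R + 1) :=
    ball_subset_closedBall.trans (closedBall_subset_closedBall (by linarith))
  have hderiv (i : ι) (y : E) (hy : y ∈ ball (0 : E) R) :
      ‖fderiv ℂ (f i) y‖ ≤ 2 * v i := by
    have hmaps : MapsTo (f i) (ball y 1) (closedBall (f i y) (2 * v i)) := by
      intro z hz
      have hz' : z ∈ closedBall (0 : E) (R + 1) := by
        rw [mem_closedBall]
        linarith [dist_triangle z y 0, mem_ball.1 hz, mem_ball.1 hy]
      rw [mem_closedBall, dist_eq_norm]
      linarith [norm_sub_le (f i z) (f i y), hfv i z hz', hfv i y (hsub hy)]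
    simpa using Complex.norm_fderiv_le_div_of_mapsTo_ball (hf i).differentiableOn hmaps one_pos
  exact (hasFDerivAt_tsum_of_isPreconnected (hv.mul_left 2) isOpen_ball
    (convex_ball (0 : E) R).isPreconnected (fun i y _ => (hf i y).hasFDerivAt) hderiv hx
    (hv.of_norm_bounded fun i => hfv i x (hsub hx)) hx).differentiableAt

/-- On a compact set, multiplying by a high power of a function bounded by `1 / 2` makes a
continuous function arbitrarily small. -/
theorem IsCompact.exists_norm_mul_pow_le {X : Type*} [TopologicalSpace X] {K : Set X}
    (hK : IsCompact K) {g h : X → ℂ} (hg : ContinuousOn g K) (hh : ∀ x ∈ K, ‖h x‖ ≤ 1 / 2)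
    {ε : ℝ} (hε : 0 < ε) : ∃ N : ℕ, ∀ x ∈ K, ‖g x * h x ^ N‖ ≤ ε := by
  obtain ⟨C, hC⟩ := hK.exists_bound_of_continuousOn hg
  have hlim : Tendsto (fun N : ℕ => max C 0 * (1 / 2 : ℝ) ^ N) atTop (nhds 0) := by
    simpa using (tendsto_pow_atTop_nhds_zero_of_lt_one (r := (1 / 2 : ℝ))
      (by norm_num) (by norm_num)).const_mul (max C 0)
  obtain ⟨N, hN⟩ := (hlim.eventually_lt_const hε).exists
  refine ⟨N, fun x hx => ?_⟩
  rw [norm_mul, norm_pow]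
  refine le_trans ?_ hN.le
  gcongr
  · exact (hC x hx).trans (le_max_left _ _)
  · exact hh x hx

/-- There is an entire function that is `1` at `0` and vanishes at every other integer. -/
theorem Complex.exists_differentiable_eq_one_zero_and_int_eq_zero :
    ∃ S : ℂ → ℂ, Differentiable ℂ S ∧ S 0 = 1 ∧ ∀ k : ℤ, k ≠ 0 → S k = 0 := by
  refine ⟨fun w => dslope Complex.sin 0 (w * Real.pi), ?_, ?_, fun k hk => ?_⟩
  · have h : Differentiable ℂ (dslope Complex.sin 0) := by
      rw [← differentiableOn_univ, Complex.differentiableOn_dslope univ_mem]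
      exact Complex.differentiable_sin.differentiableOn
    exact h.comp (differentiable_id.mul_const _)
  · simp
  · have hne : (k : ℂ) * Real.pi ≠ 0 := by simp [hk, Real.pi_ne_zero]
    simp [dslope_of_ne _ hne, slope, Complex.sin_int_mul_pi]


/-- Given any family `φ k : ℂ^{n-1} → ℂ` (indexed by `k : ℤ`) of entire
functions, with `n = m + 1 ≥ 2`, there is an entire function `Φ : ℂ^n → ℂ` interpolating
the family along integer values of the first coordinate. -/
theorem interpolation_of_entire_family (m : ℕ) (hm : 1 ≤ m)
    (φ : ℤ → ((Fin m → ℂ) → ℂ))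
    (hφ : ∀ k : ℤ, Differentiable ℂ (φ k)) :
    ∃ Φ : (Fin (m + 1) → ℂ) → ℂ, Differentiable ℂ Φ ∧
      ∀ (k : ℤ) (z : Fin m → ℂ), Φ (Fin.cons (k : ℂ) z) = φ k z := by
  obtain ⟨S, hS, hS0, hSk⟩ := Complex.exists_differentiable_eq_one_zero_and_int_eq_zero
  obtain ⟨u, hu0, _, hu, -⟩ := posSumOfEncodable one_pos ℤ
  let g : ℤ → (Fin (m + 1) → ℂ) → ℂ := fun k x => S (x 0 - k) * φ k fun i => x i.succ
  -- For `k ≠ 0` this is `x 0 / k`, while it is constantly `1` for `k = 0`.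
  let h : ℤ → (Fin (m + 1) → ℂ) → ℂ := fun k x => 1 + (x 0 - k) / k
  have hg (k : ℤ) : Differentiable ℂ (g k) :=
    (hS.comp (by fun_prop)).mul ((hφ k).comp (by fun_prop))
  have hh (k : ℤ) : Differentiable ℂ (h k) := by fun_prop
  have hN (k : ℤ) : ∃ N : ℕ, k ≠ 0 →
      ∀ x ∈ closedBall (0 : Fin (m + 1) → ℂ) (|(k : ℝ)| / 2), ‖g k x * h k x ^ N‖ ≤ u k := by
    by_cases hk : k = 0
    · exact ⟨0, fun h => absurd hk h⟩
    have hkC : (k : ℂ) ≠ 0 := Int.cast_ne_zero.2 hk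
    have hkR : 0 < |(k : ℝ)| := abs_pos.2 (Int.cast_ne_zero.2 hk)
    have hhalf (x : Fin (m + 1) → ℂ) (hx : x ∈ closedBall 0 (|(k : ℝ)| / 2)) :
        ‖h k x‖ ≤ 1 / 2 := by
      have hx0 : ‖x 0‖ ≤ |(k : ℝ)| / 2 := (norm_le_pi_norm x 0).trans (by simpa using hx)
      have heq : h k x = x 0 / k := by
        simp only [h]
        field_simp
        ring
      rw [heq, norm_div, Complex.norm_intCast, div_le_iff₀ hkR]
      linarith
    obtain ⟨N, hN⟩ := (isCompact_closedBall _ _).exists_norm_mul_pow_le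
      (hg k).continuous.continuousOn hhalf (hu0 k)
    exact ⟨N, fun _ => hN⟩
  choose N hN using hN
  refine ⟨fun x => ∑' k, g k x * h k x ^ N k,
    differentiable_tsum_of_eventually_norm_le hu.summable (fun k => (hg k).mul ((hh k).pow _))
      fun R => ?_, fun k z => ?_⟩
  · have hlarge : ∀ᶠ k : ℤ in cofinite, 2 * R ≤ |(k : ℝ)| := by
      have := tendsto_norm_cocompact_atTop.comp Int.tendsto_coe_cofinite
      exact this.eventually_ge_atTop (2 * R)
    filter_upwards [hlarge, (finite_singleton (0 : ℤ)).compl_mem_cofinite] with k hk hk0 x hx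
    exact hN k hk0 x (closedBall_subset_closedBall (by linarith) hx)
  · beta_reduce
    rw [tsum_eq_single k fun j hj => ?_]
    · simp [g, h, hS0]
    · have : S (k - j) = 0 := by exact_mod_cast hSk (k - j) (sub_ne_zero.2 hj.symm)
      simp [g, this]
end

section
/- (Complex-analytic Nullstellensatz for shifted integer lattices.) Let n ≥ 1, let 1 ≤ m ≤ n, and let α = (α₁, …, α_n) ∈ ℂ^n. Suppose f : ℂ^n → ℂ is entire and f(z) = 0 for every z = (z₁, …, z_n) ∈ ℂ^n such that z_i − α_i ∈ ℤ for every i with 1 ≤ i ≤ m. Then f belongs to the ideal I_α: there exist entire functions ψ₁, …, ψ_n : ℂ^n → ℂ such that f(z) = Σ_{i=1}^{n} (exp(2πi·z_i) − exp(2πi·α_i))·ψ_i(z) for all z ∈ ℂ^n. -/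
open Complex Metric Set Filter Function Topology

/-- A circle integral of a function holomorphic in a parameter and in the integration variable is
holomorphic in the parameter. -/
lemma differentiableAt_circleIntegral_param {n : ℕ} {Φ : (Fin n → ℂ) × ℂ → ℂ} {p : Fin n → ℂ}
    {c : ℂ} {R ρ : ℝ} (hR : 0 ≤ R) (hρ : 0 < ρ)
    (hΦ : ∀ z ∈ ball p ρ, ∀ w ∈ sphere c R, DifferentiableAt ℂ Φ (z, w)) :
    DifferentiableAt ℂ (fun z ↦ ∮ w in C(c, R), Φ (z, w)) p := by
  have hcompact : IsCompact (closedBall p (ρ / 2) ×ˢ sphere c R) :=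
    (isCompact_closedBall _ _).prod (isCompact_sphere _ _)
  have hsub : closedBall p (ρ / 2) ⊆ ball p ρ := closedBall_subset_ball (by linarith)
  obtain ⟨M, hM⟩ := hcompact.exists_bound_of_continuousOn (f := Φ) fun x hx ↦
    (hΦ x.1 (hsub hx.1) x.2 hx.2).continuousAt.continuousWithinAt
  have hcm (θ : ℝ) : circleMap c R θ ∈ sphere c R := circleMap_mem_sphere c hR θ
  have hslice {z : Fin n → ℂ} (hz : z ∈ ball p ρ) (θ : ℝ) :
      HasFDerivAt (fun z ↦ Φ (z, circleMap c R θ))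
        ((fderiv ℂ Φ (z, circleMap c R θ)).comp (.inl ℂ (Fin n → ℂ) ℂ)) z :=
    (hΦ z hz _ (hcm θ)).hasFDerivAt.comp z (hasFDerivAt_prodMk_left z (circleMap c R θ))
  have hcont {z : Fin n → ℂ} (hz : z ∈ ball p ρ) :
      Continuous fun θ ↦ deriv (circleMap c R) θ • Φ (z, circleMap c R θ) := by
    have hd : Continuous (deriv (circleMap c R)) := by
      simp only [funext (deriv_circleMap c R)]
      fun_prop
    refine hd.smul (continuous_iff_continuousAt.2 fun θ ↦ ?_)
    exact (hΦ z hz _ (hcm θ)).continuousAt.comp (f := fun θ ↦ (z, circleMap c R θ))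
      (by fun_prop)
  refine (intervalIntegral.hasFDerivAt_integral_of_dominated_of_fderiv_le
    (F := fun z θ ↦ deriv (circleMap c R) θ • Φ (z, circleMap c R θ))
    (F' := fun z θ ↦ deriv (circleMap c R) θ •
      (fderiv ℂ Φ (z, circleMap c R θ)).comp (.inl ℂ (Fin n → ℂ) ℂ))
    (bound := fun _ ↦ R * ((M + M) / (ρ / 4)))
    (ball_mem_nhds p (by linarith : 0 < ρ / 4)) ?_ ?_ ?_ ?_ ?_ ?_).differentiableAt
  · filter_upwards [ball_mem_nhds p hρ] with z hz
    exact (hcont hz).aestronglyMeasurable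
  · exact (hcont (mem_ball_self hρ)).intervalIntegrable _ _
  · have hd : Measurable (deriv (circleMap c R)) := measurable_deriv _
    have hf : Measurable fun θ ↦ fderiv ℂ Φ (p, circleMap c R θ) :=
      (measurable_fderiv ℂ Φ).comp (by fun_prop)
    have hL : Continuous fun A : (Fin n → ℂ) × ℂ →L[ℂ] ℂ ↦ A.comp (.inl ℂ (Fin n → ℂ) ℂ) := by
      fun_prop
    have : SecondCountableTopology ((Fin n → ℂ) →L[ℂ] ℂ) :=
      have := FiniteDimensional.proper ℂ ((Fin n → ℂ) →L[ℂ] ℂ)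
      inferInstance
    exact (hd.smul (hL.measurable.comp hf)).aestronglyMeasurable
  · refine .of_forall fun θ _ z hz ↦ ?_
    have hsub' : ball z (ρ / 4) ⊆ closedBall p (ρ / 2) := by
      intro y hy
      have := dist_triangle y z p
      simp only [mem_ball, mem_closedBall] at *
      linarith
    have hz' : z ∈ closedBall p (ρ / 2) := hsub' (mem_ball_self (by linarith))
    rw [norm_smul]
    refine mul_le_mul (by simp [abs_of_nonneg hR]) ?_ (norm_nonneg _) hR
    rw [← (hslice (hsub hz') θ).fderiv]
    refine norm_fderiv_le_div_of_mapsTo_ball (fun y hy ↦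
      (hslice (hsub (hsub' hy)) θ).differentiableAt.differentiableWithinAt) (fun y hy ↦ ?_)
      (by linarith)
    rw [mem_closedBall, dist_eq_norm]
    exact (norm_sub_le _ _).trans
      (add_le_add (hM (y, _) ⟨hsub' hy, hcm θ⟩) (hM (z, _) ⟨hz', hcm θ⟩))
  · exact intervalIntegrable_const
  · refine .of_forall fun θ _ z hz ↦ ?_
    exact (hslice (ball_subset_ball (by linarith) hz) θ).fun_const_smul (deriv (circleMap c R) θ)

lemma differentiable_update_left {n : ℕ} (j : Fin n) (w : ℂ) :
    Differentiable ℂ fun z : Fin n → ℂ ↦ update z j w := by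
  refine differentiable_pi.2 fun i ↦ ?_
  rcases eq_or_ne i j with rfl | h
  · simp
  · simpa [h] using differentiable_apply i

lemma differentiable_update_pair {n : ℕ} (j : Fin n) :
    Differentiable ℂ fun x : (Fin n → ℂ) × ℂ ↦ update x.1 j x.2 := by
  refine differentiable_pi.2 fun i ↦ ?_
  rcases eq_or_ne i j with rfl | h
  · simp
  · simp only [update_of_ne h]
    fun_prop

/-- The divided difference of an entire function in one of its variables is entire. -/
lemma differentiable_dslope_update {n : ℕ} {h : (Fin n → ℂ) → ℂ} (hh : Differentiable ℂ h)
    (j : Fin n) (a : ℂ) :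
    Differentiable ℂ fun z ↦ dslope (fun w ↦ h (update z j w)) a (z j) := by
  intro p
  set R : ℝ := dist (p j) a + 2
  have hR : 0 < R := by positivity
  have hdist {z : Fin n → ℂ} (hz : z ∈ ball p 1) : z j ∈ ball a R := by
    have h1 := dist_le_pi_dist z p j
    have h2 := dist_triangle (z j) (p j) a
    rw [mem_ball] at *
    linarith
  let Φ : (Fin n → ℂ) × ℂ → ℂ := fun x ↦
    (x.2 - x.1 j)⁻¹ * ((x.2 - a)⁻¹ * (h (update x.1 j x.2) - h (update x.1 j a)))
  have hΦ : DifferentiableAt ℂ (fun z ↦ ∮ w in C(a, R), Φ (z, w)) p := by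
    refine differentiableAt_circleIntegral_param hR.le one_pos fun z hz w hw ↦ ?_
    have h1 : w - z j ≠ 0 := by
      rintro h0
      have := hdist hz
      rw [← sub_eq_zero.1 h0, mem_ball, mem_sphere.1 hw] at this
      exact this.false
    have h2 : w - a ≠ 0 := by
      rintro h0
      rw [sub_eq_zero.1 h0, mem_sphere, dist_self] at hw
      exact hR.ne hw
    have h3 : Differentiable ℂ fun x : (Fin n → ℂ) × ℂ ↦ h (update x.1 j x.2) :=
      hh.comp (differentiable_update_pair j)
    have h4 : Differentiable ℂ fun x : (Fin n → ℂ) × ℂ ↦ h (update x.1 j a) :=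
      hh.comp ((differentiable_update_left j a).comp differentiable_fst)
    have h5 : DifferentiableAt ℂ (fun x : (Fin n → ℂ) × ℂ ↦ x.2 - x.1 j) (z, w) := by fun_prop
    have h6 : DifferentiableAt ℂ (fun x : (Fin n → ℂ) × ℂ ↦ x.2 - a) (z, w) := by fun_prop
    exact (h5.inv h1).mul ((h6.inv h2).mul ((h3 _).sub (h4 _)))
  refine (hΦ.const_mul (2 * Real.pi * I)⁻¹).congr_of_eventuallyEq ?_
  filter_upwards [ball_mem_nhds p one_pos] with z hz
  have hH : Differentiable ℂ fun w ↦ h (update z j w) :=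
    hh.comp ((differentiable_update_pair j).comp
      (f := fun w : ℂ ↦ (z, w)) (by fun_prop))
  have hD : DifferentiableOn ℂ (dslope (fun w ↦ h (update z j w)) a) univ :=
    (differentiableOn_dslope univ_mem).2 hH.differentiableOn
  have key := (hD.mono (subset_univ _)).diffContOnCl_ball
    (U := univ) (c := a) (R := R) (subset_univ _) |>.circleIntegral_sub_inv_smul (hdist hz)
  have hpi : (2 * Real.pi * I : ℂ) ≠ 0 := by simp [Real.pi_ne_zero]
  rw [eq_inv_mul_iff_mul_eq₀ hpi, ← smul_eq_mul, ← key]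
  refine circleIntegral.integral_congr hR.le fun w hw ↦ ?_
  have hwa : w ≠ a := by
    rintro rfl
    rw [mem_sphere, dist_self] at hw
    exact hR.ne hw
  simp [Φ, dslope_of_ne _ hwa, slope_def_module]

/-- An entire function of several variables vanishing wherever `G (z j) = 0` is divisible by
`G (z j)`, provided the zeros of the entire function `G` are simple. -/
lemma exists_eq_mul_of_vanishing {n : ℕ} {h : (Fin n → ℂ) → ℂ} (hh : Differentiable ℂ h)
    (j : Fin n) {G : ℂ → ℂ} (hG : Differentiable ℂ G) (hsimple : ∀ w, G w = 0 → deriv G w ≠ 0)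
    (hv : ∀ z, G (z j) = 0 → h z = 0) :
    ∃ ψ : (Fin n → ℂ) → ℂ, Differentiable ℂ ψ ∧ ∀ z, h z = G (z j) * ψ z := by
  classical
  let ψ : (Fin n → ℂ) → ℂ := fun z ↦
    if G (z j) = 0 then dslope (fun w ↦ h (update z j w)) (z j) (z j) / deriv G (z j)
    else h z / G (z j)
  have hGj : Differentiable ℂ fun z : Fin n → ℂ ↦ G (z j) := hG.comp (differentiable_apply j)
  refine ⟨ψ, fun p ↦ ?_, fun z ↦ ?_⟩
  · by_cases hp : G (p j) = 0
    · set a := p j with ha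
      have hdG : Differentiable ℂ (dslope G a) := by
        rw [← differentiableOn_univ]
        exact (differentiableOn_dslope univ_mem).2 hG.differentiableOn
      have hdGj : Differentiable ℂ fun z : Fin n → ℂ ↦ dslope G a (z j) :=
        hdG.comp (differentiable_apply j)
      have hne : dslope G a (p j) ≠ 0 := by
        rw [← ha, dslope_same]
        exact hsimple a hp
      refine ((differentiable_dslope_update hh j a p).fun_mul
        ((hdGj p).fun_inv hne)).congr_of_eventuallyEq ?_
      filter_upwards [(hdGj p).continuousAt.eventually_ne hne] with z hz
      by_cases hza : z j = a
      · simp [ψ, hza, hp, div_eq_mul_inv]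
      · have hGz : G (z j) = (z j - a) * dslope G a (z j) := by
          have := sub_smul_dslope G a (z j)
          rw [hp, sub_zero, smul_eq_mul] at this
          exact this.symm
        have hza' : z j - a ≠ 0 := sub_ne_zero.2 hza
        have hhz : h z = (z j - a) * dslope (fun w ↦ h (update z j w)) a (z j) := by
          have := sub_smul_dslope (fun w ↦ h (update z j w)) a (z j)
          simp only [update_eq_self, smul_eq_mul] at this
          rw [this, hv (update z j a) (by simpa using hp), sub_zero]
        have hGz' : G (z j) ≠ 0 := by
          rw [hGz]
          exact mul_ne_zero hza' hz
        simp only [ψ, if_neg hGz']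
        rw [hGz, hhz, mul_div_mul_left _ _ hza', div_eq_mul_inv]
    · refine ((hh p).fun_mul ((hGj p).fun_inv hp)).congr_of_eventuallyEq ?_
      filter_upwards [(hGj p).continuousAt.eventually_ne hp] with z hz
      simp [ψ, hz, div_eq_mul_inv]
  · by_cases hz : G (z j) = 0
    · simp [hz, hv z hz]
    · simp only [ψ, if_neg hz]
      field_simp

/-- A series of entire functions of several variables that is eventually dominated by a summable
series on every ball has an entire sum. -/
lemma differentiable_tsum_of_eventually_le {ι : Type*} {n : ℕ} {F : ι → (Fin n → ℂ) → ℂ}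
    (hF : ∀ k, Differentiable ℂ (F k))
    (hbound : ∀ R : ℝ, ∃ u : ι → ℝ, Summable u ∧
      ∀ᶠ k in cofinite, ∀ z, ‖z‖ ≤ R → ‖F k z‖ ≤ u k) :
    Differentiable ℂ fun z ↦ ∑' k, F k z := by
  classical
  intro p
  obtain ⟨u, hu, hev⟩ := hbound (‖p‖ + 2)
  choose M hM using fun k ↦
    (isCompact_closedBall (0 : Fin n → ℂ) (‖p‖ + 2)).exists_bound_of_continuousOn
    (hF k).continuous.continuousOn
  let v : ι → ℝ := fun k ↦ if ∀ z, ‖z‖ ≤ ‖p‖ + 2 → ‖F k z‖ ≤ u k then u k else M k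
  have hv : Summable v := by
    refine (summable_congr_cofinite ?_).2 hu
    filter_upwards [hev] with k hk
    exact if_pos hk
  have hFv (k : ι) (z : Fin n → ℂ) (hz : ‖z‖ ≤ ‖p‖ + 2) : ‖F k z‖ ≤ v k := by
    by_cases h : ∀ z, ‖z‖ ≤ ‖p‖ + 2 → ‖F k z‖ ≤ u k
    · simpa only [v, if_pos h] using h z hz
    · simpa only [v, if_neg h] using hM k z (by simpa using hz)
  have hnorm {z y : Fin n → ℂ} (hz : z ∈ ball p 1) (hy : y ∈ ball z 1) : ‖y‖ ≤ ‖p‖ + 2 := by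
    have h1 := norm_le_norm_add_norm_sub' y p
    have h2 := dist_triangle y z p
    simp only [mem_ball] at *
    rw [dist_eq_norm y p] at h2
    linarith
  refine (hasFDerivAt_tsum_of_isPreconnected (u := fun k ↦ (v k + v k) / 1)
    (f' := fun k z ↦ fderiv ℂ (F k) z) (by simpa using hv.add hv) isOpen_ball
    (convex_ball p 1).isPreconnected (fun k z _ ↦ (hF k z).hasFDerivAt) (fun k z hz ↦ ?_)
    (mem_ball_self one_pos) (hv.of_norm_bounded fun k ↦ hFv k p (by linarith))
    (mem_ball_self one_pos)).differentiableAt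
  refine norm_fderiv_le_div_of_mapsTo_ball (hF k).differentiableOn (fun y hy ↦ ?_) one_pos
  rw [mem_closedBall, dist_eq_norm]
  exact (norm_sub_le _ _).trans
    (add_le_add (hFv k y (hnorm hz hy)) (hFv k z (hnorm hz (mem_ball_self one_pos))))

/-- Entire functions prescribed on the hyperplanes `z j = a + k`, `k ∈ ℤ`, can be interpolated by
one entire function, given an entire function `G` with simple zeros on `a + ℤ`. -/
lemma exists_differentiable_interpolation {n : ℕ} (j : Fin n) (a : ℂ) {G : ℂ → ℂ}
    (hG : Differentiable ℂ G) (hG0 : ∀ k : ℤ, G (a + k) = 0) {d : ℂ} (hd : d ≠ 0)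
    (hGd : ∀ k : ℤ, deriv G (a + k) = d) {φ : ℤ → (Fin n → ℂ) → ℂ}
    (hφ : ∀ k, Differentiable ℂ (φ k)) :
    ∃ Ψ : (Fin n → ℂ) → ℂ, Differentiable ℂ Ψ ∧ ∀ (k : ℤ) z, z j = a + k → Ψ z = φ k z := by
  classical
  obtain ⟨u, hu0, c, hu, -⟩ := NNReal.exists_pos_sum_of_countable (one_ne_zero (α := NNReal)) ℤ
  choose M hM using fun k : ℤ ↦
    (isCompact_closedBall (0 : Fin n → ℂ) |(k : ℝ)|).exists_bound_of_continuousOn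
    (hφ k).continuous.continuousOn
  have hN (k : ℤ) : ∃ N : ℕ, M k * (1 / 2 : ℝ) ^ N ≤ u k := by
    have hlim : Tendsto (fun N : ℕ ↦ M k * (1 / 2 : ℝ) ^ N) atTop (𝓝 (M k * 0)) :=
      (tendsto_pow_atTop_nhds_zero_of_lt_one (by norm_num) (by norm_num)).const_mul _
    rw [mul_zero] at hlim
    exact (hlim.eventually_le_const (NNReal.coe_pos.2 (hu0 k))).exists
  choose N hN using hN
  let s : ℤ → ℂ → ℂ := fun k w ↦ dslope G (a + k) w / d
  have hs (k : ℤ) : Differentiable ℂ (s k) := by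
    refine Differentiable.div_const ?_ d
    rw [← differentiableOn_univ]
    exact (differentiableOn_dslope univ_mem).2 hG.differentiableOn
  let F : ℤ → (Fin n → ℂ) → ℂ := fun k z ↦
    φ k z * s k (z j) * ((z j - a) / k) ^ (if k = 0 then 0 else N k)
  have hF (k : ℤ) : Differentiable ℂ (F k) := by
    refine ((hφ k).mul ((hs k).comp (differentiable_apply j))).mul ?_
    fun_prop
  refine ⟨fun z ↦ ∑' k, F k z, differentiable_tsum_of_eventually_le hF fun R ↦ ?_,
    fun l z hz ↦ ?_⟩
  · obtain ⟨B, hB⟩ := (isCompact_closedBall (0 : ℂ) R).exists_bound_of_continuousOn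
      hG.continuous.continuousOn
    refine ⟨fun k ↦ u k * (B / ‖d‖), (NNReal.summable_coe.2 hu.summable).mul_right _, ?_⟩
    obtain ⟨K, hK⟩ := exists_nat_gt (2 * (|R| + ‖a‖) + 2)
    have hfin : {k : ℤ | ¬ (K : ℤ) ≤ |k|}.Finite := by
      refine (Set.finite_Icc (-(K : ℤ)) K).subset fun k hk ↦ ?_
      exact abs_le.1 (not_le.1 hk).le
    have hlarge : ∀ᶠ k : ℤ in cofinite, (K : ℤ) ≤ |k| := hfin
    filter_upwards [hlarge] with k hk z hz
    have hk' : (K : ℝ) ≤ |(k : ℝ)| := by exact_mod_cast hk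
    have hzj : ‖z j‖ ≤ R := (norm_le_pi_norm z j).trans hz
    have ha := norm_nonneg a
    have hR := le_abs_self R
    have hR' := abs_nonneg R
    have hk0 : k ≠ 0 := by
      rintro rfl
      simp only [Int.cast_zero, abs_zero] at hk'
      linarith
    have hknorm : ‖(k : ℂ)‖ = |(k : ℝ)| := by simp
    have hkpos : 0 < |(k : ℝ)| := by linarith
    have hdiff : ‖z j - a‖ ≤ |(k : ℝ)| / 2 := by
      have := norm_sub_le (z j) a
      linarith
    have hfar : 1 ≤ ‖z j - (a + k)‖ := by
      have := norm_sub_norm_le (k : ℂ) (z j - a)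
      rw [hknorm, norm_sub_rev (k : ℂ), sub_sub] at this
      linarith
    have hφz : ‖φ k z‖ ≤ M k := hM k z (by rw [mem_closedBall_zero_iff]; linarith)
    have hsz : ‖s k (z j)‖ ≤ B / ‖d‖ := by
      have hne : z j ≠ a + k := by
        intro h0
        rw [h0, sub_self, norm_zero] at hfar
        linarith
      have hGz := hB (z j) (by simpa using hzj)
      simp only [s]
      rw [norm_div, dslope_of_ne _ hne, slope_def_module, hG0, sub_zero, norm_smul, norm_inv]
      gcongr
      exact (mul_le_of_le_one_left (norm_nonneg _) (inv_le_one_of_one_le₀ hfar)).trans hGz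
    have hq : ‖(z j - a) / (k : ℂ)‖ ≤ 1 / 2 := by
      rw [norm_div, hknorm, div_le_iff₀ hkpos]
      linarith
    have hM0 : 0 ≤ M k := (norm_nonneg _).trans hφz
    have hB0 : 0 ≤ B / ‖d‖ := (norm_nonneg _).trans hsz
    calc ‖F k z‖ = ‖φ k z‖ * ‖s k (z j)‖ * ‖(z j - a) / (k : ℂ)‖ ^ N k := by
          simp only [F, if_neg hk0, norm_mul, norm_pow]
      _ ≤ M k * (B / ‖d‖) * (1 / 2) ^ N k := by gcongr
      _ = M k * (1 / 2) ^ N k * (B / ‖d‖) := by ring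
      _ ≤ u k * (B / ‖d‖) := by
          gcongr
          exact hN k
  · simp only
    rw [tsum_eq_single l]
    · have hsl : s l (a + l) = 1 := by simp [s, dslope_same, hGd, hd]
      rcases eq_or_ne l 0 with rfl | hl
      · simp only [F, hz, hsl]
        simp
      · have : (l : ℂ) ≠ 0 := by exact_mod_cast hl
        simp only [F, hz, hsl]
        simp [this]
    · intro k hkl
      have hne : a + (l : ℂ) ≠ a + k := by
        intro h0
        exact hkl (by exact_mod_cast (add_left_cancel h0).symm)
      have : s k (a + l) = 0 := by
        simp [s, dslope_of_ne _ hne, slope_def_module, hG0]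
      simp [F, hz, this]

/-- `exp (2πi w) - exp (2πi a)` vanishes exactly when `w ∈ a + ℤ`. -/
lemma exp_two_pi_sub_eq_zero_iff {a w : ℂ} :
    exp (2 * (Real.pi : ℂ) * I * w) - exp (2 * (Real.pi : ℂ) * I * a) = 0 ↔
      ∃ k : ℤ, w = a + k := by
  have hpi : (2 * Real.pi * I : ℂ) ≠ 0 := by simp [Real.pi_ne_zero]
  rw [sub_eq_zero, exp_eq_exp_iff_exists_int]
  refine exists_congr fun k ↦ ?_
  rw [mul_comm (k : ℂ), ← mul_add, mul_right_inj' hpi]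

/-- An entire function vanishing on the lattice conditions indexed by `S` is a combination of the
generators indexed by `S`. -/
lemma exists_sum_of_vanishing_lattice {n : ℕ} (α : Fin n → ℂ) (S : Finset (Fin n)) :
    ∀ f : (Fin n → ℂ) → ℂ, Differentiable ℂ f →
      (∀ z : Fin n → ℂ, (∀ i ∈ S, ∃ w : ℤ, z i = α i + w) → f z = 0) →
      ∃ ψ : Fin n → ((Fin n → ℂ) → ℂ), (∀ i, Differentiable ℂ (ψ i)) ∧
        ∀ z : Fin n → ℂ, f z = ∑ i ∈ S,
          (exp (2 * (Real.pi : ℂ) * I * z i) - exp (2 * (Real.pi : ℂ) * I * α i)) * ψ i z := by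
  classical
  induction S using Finset.induction_on with
  | empty =>
    intro f _ hv
    exact ⟨fun _ _ ↦ 0, fun _ ↦ differentiable_const _, fun z ↦ by simp [hv z]⟩
  | insert j S hj ih =>
    intro f hf hv
    let G : ℂ → ℂ := fun w ↦
      exp (2 * (Real.pi : ℂ) * I * w) - exp (2 * (Real.pi : ℂ) * I * α j)
    have hpi : (2 * Real.pi * I : ℂ) ≠ 0 := by simp [Real.pi_ne_zero]
    have hG : Differentiable ℂ G := by fun_prop
    have hG0 (w : ℂ) : G w = 0 ↔ ∃ k : ℤ, w = α j + k := exp_two_pi_sub_eq_zero_iff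
    have hderiv (w : ℂ) (hw : G w = 0) :
        deriv G w = exp (2 * (Real.pi : ℂ) * I * α j) * (2 * (Real.pi : ℂ) * I) := by
      rw [← sub_eq_zero.1 hw]
      simpa [G] using (((hasDerivAt_id w).const_mul (2 * (Real.pi : ℂ) * I)).cexp.sub_const
        (exp (2 * (Real.pi : ℂ) * I * α j))).deriv
    have hd : exp (2 * (Real.pi : ℂ) * I * α j) * (2 * (Real.pi : ℂ) * I) ≠ 0 :=
      mul_ne_zero (exp_ne_zero _) hpi
    have hslice (k : ℤ) := ih (fun z ↦ f (update z j (α j + k)))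
      (hf.comp (differentiable_update_left j _)) fun z hz ↦ hv _ fun i hi ↦ by
        rcases Finset.mem_insert.1 hi with rfl | hi
        · exact ⟨k, by simp⟩
        · rw [update_of_ne (ne_of_mem_of_not_mem hi hj)]
          exact hz i hi
    choose φ hφ hφeq using hslice
    choose Ψ hΨ hΨeq using fun i ↦ exists_differentiable_interpolation j (α j) hG
      (fun k ↦ (hG0 _).2 ⟨k, rfl⟩) hd (fun k ↦ hderiv _ ((hG0 _).2 ⟨k, rfl⟩))
      (fun k ↦ hφ k i)
    have hdiff : Differentiable ℂ fun z : Fin n → ℂ ↦ f z - ∑ i ∈ S,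
        (exp (2 * (Real.pi : ℂ) * I * z i) - exp (2 * (Real.pi : ℂ) * I * α i)) * Ψ i z := by
      fun_prop
    obtain ⟨χ, hχ, hχeq⟩ := exists_eq_mul_of_vanishing hdiff j hG
      (fun w hw ↦ (hderiv w hw).trans_ne hd) fun z hz ↦ by
        obtain ⟨k, hk⟩ := (hG0 _).1 hz
        have := hφeq k z
        rw [← hk, update_eq_self] at this
        simp only [this, hΨeq _ k z hk, sub_self]
    refine ⟨update Ψ j χ, fun i ↦ ?_, fun z ↦ ?_⟩
    · rcases eq_or_ne i j with rfl | hi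
      · simpa using hχ
      · simpa [hi] using hΨ i
    · rw [Finset.sum_insert hj, update_self]
      refine (sub_eq_iff_eq_add.1 (hχeq z)).trans ?_
      congr 1
      refine Finset.sum_congr rfl fun i hi ↦ ?_
      rw [update_of_ne (ne_of_mem_of_not_mem hi hj)]


/-- Complex-analytic Nullstellensatz for shifted integer lattices.
If an entire function `f : ℂ^n → ℂ` vanishes at every point whose first `m`
coordinates lie in `α_i + ℤ`, then `f` lies in the ideal generated by the
functions `z ↦ exp(2πi z_i) - exp(2πi α_i)`, `i = 1, …, n`. -/
theorem nullstellensatz_shifted_lattice (n m : ℕ) (hn : 1 ≤ n) (hm : 1 ≤ m) (hmn : m ≤ n)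
    (α : Fin n → ℂ) (f : (Fin n → ℂ) → ℂ) (hf : Differentiable ℂ f)
    (hvanish : ∀ z : Fin n → ℂ,
      (∀ i : Fin n, (i : ℕ) < m → ∃ w : ℤ, z i - α i = (w : ℂ)) → f z = 0) :
    ∃ ψ : Fin n → ((Fin n → ℂ) → ℂ), (∀ i, Differentiable ℂ (ψ i)) ∧
      ∀ z : Fin n → ℂ,
        f z = ∑ i : Fin n,
          (Complex.exp (2 * (Real.pi : ℂ) * Complex.I * z i) -
            Complex.exp (2 * (Real.pi : ℂ) * Complex.I * α i)) * ψ i z := by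
  classical
  obtain ⟨ψ, hψ, hfψ⟩ := exists_sum_of_vanishing_lattice α {i : Fin n | (i : ℕ) < m} f hf
    fun z hz ↦ hvanish z fun i hi ↦ (hz i (by simpa using hi)).imp fun w hw ↦ by simp [hw]
  refine ⟨fun i z ↦ if (i : ℕ) < m then ψ i z else 0, fun i ↦ ?_, fun z ↦ ?_⟩
  · by_cases hi : (i : ℕ) < m
    · simpa only [if_pos hi] using hψ i
    · simp [hi]
  · rw [hfψ z, Finset.sum_filter]
    exact Finset.sum_congr rfl fun i _ ↦ by
      by_cases hi : (i : ℕ) < m <;> simp [hi]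
end

section
/- (Periodic functions agree with their discrete Fourier transform modulo the lattice ideal.) Let ℓ ≥ 1 be an integer, let 1 ≤ m ≤ n, and let α = (α₁, …, α_n) ∈ ℂ^n. Suppose f : ℂ^n → ℂ is entire and for every z ∈ ℂ^n with z_j − α_j ∈ ℤ for all j = 1, …, m and every i with 1 ≤ i ≤ m one has f(z + ℓ·e_i) = f(z), where e_i is the i-th standard basis vector. For k ∈ {0,…,ℓ−1}^m define a_k : ℂ^{n−m} → ℂ by a_k(z_{m+1}, …, z_n) = ℓ^{−m} · Σ_{j ∈ {0,…,ℓ−1}^m} exp(−(2πi/ℓ)·Σ_{i=1}^{m} k_i(α_i + j_i)) · f(α₁ + j₁, …, α_m + j_m, z_{m+1}, …, z_n). Then the entire function z ↦ f(z) − Σ_{k ∈ {0,…,ℓ−1}^m} a_k(z_{m+1}, …, z_n) · exp((2πi/ℓ)·Σ_{i=1}^{m} k_i z_i) belongs to the ideal I_α: there exist entire functions ψ₁, …, ψ_n : ℂ^n → ℂ such that f(z) − Σ_{k} a_k(z_{m+1}, …, z_n)·exp((2πi/ℓ)·Σ_{i=1}^{m} k_i z_i) = Σ_{i=1}^{n}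 (exp(2πi·z_i) − exp(2πi·α_i))·ψ_i(z) for all z ∈ ℂ^n. -/
open Complex Metric Set Filter Topology

/-- Cauchy estimate for the Fréchet derivative of a bounded holomorphic function. -/
theorem norm_fderiv_le_of_norm_le {E : Type*} [NormedAddCommGroup E] [NormedSpace ℂ E]
    {f : E → ℂ} {x : E} {r M : ℝ} (hr : 0 < r) (hd : DifferentiableOn ℂ f (ball x r))
    (hM : ∀ y ∈ ball x r, ‖f y‖ ≤ M) : ‖fderiv ℂ f x‖ ≤ 2 * M / r := by
  refine norm_fderiv_le_div_of_mapsTo_ball hd (fun y hy => ?_) hr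
  rw [mem_closedBall, dist_eq_norm]
  linarith [norm_sub_le (f y) (f x), hM y hy, hM x (mem_ball_self hr)]

theorem continuousOn_fderiv_param {E : Type*} [NormedAddCommGroup E] [NormedSpace ℂ E]
    [FiniteDimensional ℂ E] {F : E → ℂ → ℂ} {x : E} {r : ℝ} {K : Set ℂ} (hr : 0 < r)
    (hK : IsCompact K) (hc : ContinuousOn (Function.uncurry F) (closedBall x r ×ˢ K))
    (hd : ∀ ζ ∈ K, DifferentiableOn ℂ (F · ζ) (ball x r)) :
    ContinuousOn (fun ζ => fderiv ℂ (F · ζ) x) K := by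
  have : ProperSpace E := FiniteDimensional.proper ℂ E
  have hu := ((isCompact_closedBall x r).prod hK).uniformContinuousOn_of_continuous hc
  rw [Metric.uniformContinuousOn_iff] at hu
  rw [Metric.continuousOn_iff]
  intro ζ hζ ε hε
  obtain ⟨δ, hδ, h⟩ := hu (ε * r / 4) (by positivity)
  refine ⟨δ, hδ, fun η hη hd' => ?_⟩
  have hxx : ∀ ζ ∈ K, DifferentiableAt ℂ (F · ζ) x := fun ζ hζ =>
    (hd ζ hζ).differentiableAt (ball_mem_nhds _ hr)
  rw [dist_eq_norm, ← fderiv_fun_sub (hxx η hη) (hxx ζ hζ)]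
  refine (norm_fderiv_le_of_norm_le (M := ε * r / 4) hr ((hd η hη).sub (hd ζ hζ))
    fun y hy => ?_).trans_lt ?_
  · have := h (y, η) ⟨ball_subset_closedBall hy, hη⟩ (y, ζ) ⟨ball_subset_closedBall hy, hζ⟩
      (by simpa [Prod.dist_eq] using hd')
    rw [dist_eq_norm] at this
    exact this.le
  · field_simp
    linarith

theorem differentiableAt_circleIntegral_param_s4 {E : Type*} [NormedAddCommGroup E]
    [NormedSpace ℂ E] [FiniteDimensional ℂ E] {F : E → ℂ → ℂ} {x : E} {r R : ℝ} {a : ℂ}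
    (hr : 0 < r) (hR : 0 ≤ R)
    (hc : ContinuousOn (Function.uncurry F) (closedBall x r ×ˢ sphere a R))
    (hd : ∀ ζ ∈ sphere a R, DifferentiableOn ℂ (F · ζ) (ball x r)) :
    DifferentiableAt ℂ (fun y => ∮ ζ in C(a, R), F y ζ) x := by
  have : ProperSpace E := FiniteDimensional.proper ℂ E
  obtain ⟨M, hM⟩ := ((isCompact_closedBall x r).prod (isCompact_sphere a R))
    |>.exists_bound_of_continuousOn hc
  have hs : ∀ θ, circleMap a R θ ∈ sphere a R := circleMap_mem_sphere a hR
  have hcd : Continuous (fun θ => deriv (circleMap a R) θ) := by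
    simp only [deriv_circleMap]; fun_prop
  have hFc : ∀ y ∈ closedBall x r,
      Continuous fun θ => deriv (circleMap a R) θ • F y (circleMap a R θ) := fun y hy => by
    refine hcd.smul ?_
    exact hc.comp_continuous (f := fun θ => (y, circleMap a R θ)) (by fun_prop) fun θ => ⟨hy, hs θ⟩
  have hF'c : Continuous fun θ =>
      deriv (circleMap a R) θ • fderiv ℂ (F · (circleMap a R θ)) x :=
    hcd.smul ((continuousOn_fderiv_param hr (isCompact_sphere a R) hc hd).comp_continuous
      (continuous_circleMap a R) hs)
  have key := intervalIntegral.hasFDerivAt_integral_of_dominated_of_fderiv_le (𝕜 := ℂ)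
    (μ := MeasureTheory.volume) (a := 0) (b := 2 * Real.pi) (x₀ := x) (s := ball x (r / 2))
    (F := fun y θ => deriv (circleMap a R) θ • F y (circleMap a R θ))
    (F' := fun y θ => deriv (circleMap a R) θ • fderiv ℂ (F · (circleMap a R θ)) y)
    (bound := fun _ => R * (2 * M / (r / 2)))
    (ball_mem_nhds _ (by positivity))
    (by
      filter_upwards [closedBall_mem_nhds x hr] with y hy
      exact (hFc y hy).aestronglyMeasurable)
    ((hFc x (mem_closedBall_self hr.le)).intervalIntegrable _ _)
    hF'c.aestronglyMeasurable
    (by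
      refine Eventually.of_forall fun θ _ y hy => ?_
      have hsub : ball y (r / 2) ⊆ ball x r := ball_subset_ball' (by
        rw [mem_ball] at hy; linarith)
      rw [norm_smul]
      have h1 : ‖deriv (circleMap a R) θ‖ = R := by simp [abs_of_nonneg hR]
      rw [h1]
      refine mul_le_mul_of_nonneg_left ?_ hR
      exact norm_fderiv_le_of_norm_le (by positivity) ((hd _ (hs θ)).mono hsub)
        fun w hw => hM (w, _) ⟨ball_subset_closedBall (hsub hw), hs θ⟩)
    (by simp)
    (by
      refine Eventually.of_forall fun θ _ y hy => ?_
      have : ball x (r / 2) ⊆ ball x r := ball_subset_ball (by linarith)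
      have h := ((hd _ (hs θ)).differentiableAt (isOpen_ball.mem_nhds (this hy))).hasFDerivAt
      exact h.const_smul (deriv (circleMap a R) θ))
  exact key.differentiableAt

/-- A series of entire functions with summable bounds on every ball has an entire sum. -/
theorem differentiable_tsum_of_locally_bounded {E β : Type*} [NormedAddCommGroup E]
    [NormedSpace ℂ E] {F : β → E → ℂ} (hd : ∀ b, Differentiable ℂ (F b))
    (hb : ∀ R : ℝ, ∃ u : β → ℝ, Summable u ∧ ∀ b, ∀ z ∈ ball (0 : E) R, ‖F b z‖ ≤ u b) :
    Differentiable ℂ fun z => ∑' b, F b z := by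
  intro x
  obtain ⟨u, hu, hM⟩ := hb (‖x‖ + 2)
  have hx : x ∈ ball (0 : E) (‖x‖ + 1) := by simp
  let : NormedSpace ℝ E := NormedSpace.restrictScalars ℝ ℂ E
  refine (hasFDerivAt_tsum_of_isPreconnected (𝕜 := ℂ) (u := fun b => 2 * u b / 1)
    ((hu.mul_left 2).div_const 1) isOpen_ball
    (convex_ball (0 : E) (‖x‖ + 1)).isPreconnected (fun b y _ => (hd b y).hasFDerivAt)
    (fun b y hy => ?_) hx ?_ hx).differentiableAt
  · refine norm_fderiv_le_of_norm_le one_pos (hd b).differentiableOn fun w hw => hM b w ?_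
    refine ball_subset_ball' (?_) hw
    rw [mem_ball] at hy
    linarith
  · exact .of_norm_bounded hu fun b => hM b x (by simp)

/-- One-variable division of entire functions by an entire function with simple zeros. -/
theorem differentiable_div_of_simple_zeros {s G : ℂ → ℂ} (hs : Differentiable ℂ s)
    (hs' : ∀ ζ, s ζ = 0 → deriv s ζ ≠ 0) (hG : Differentiable ℂ G) (h0 : ∀ ζ, s ζ = 0 → G ζ = 0) :
    Differentiable ℂ fun ζ => if s ζ = 0 then deriv G ζ / deriv s ζ else G ζ / s ζ := by
  intro a
  by_cases ha : s a = 0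
  · have hds : ∀ {f : ℂ → ℂ}, Differentiable ℂ f → DifferentiableAt ℂ (dslope f a) a := fun hf =>
      ((differentiableOn_dslope univ_mem).2 hf.differentiableOn).differentiableAt univ_mem
    have hne : dslope s a a ≠ 0 := by rw [dslope_same]; exact hs' a ha
    refine ((hds hG).div (hds hs) hne).congr_of_eventuallyEq ?_
    filter_upwards [(hds hs).continuousAt.eventually_ne hne] with ζ hζ
    rcases eq_or_ne ζ a with rfl | h
    · simp [ha]
    · have h1 := sub_smul_dslope s a ζ
      have h2 := sub_smul_dslope G a ζ
      rw [ha, sub_zero, smul_eq_mul] at h1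
      rw [h0 a ha, sub_zero, smul_eq_mul] at h2
      have h3 := sub_ne_zero.2 h
      rw [if_neg (by rw [← h1]; exact mul_ne_zero h3 hζ), ← h1, ← h2, Pi.div_apply,
        mul_div_mul_left _ _ h3]
  · refine ((hG a).div (hs a) ha).congr_of_eventuallyEq ?_
    filter_upwards [(hs a).continuousAt.eventually_ne ha] with ζ hζ
    simp [hζ]

theorem differentiable_update {ι : Type*} [Fintype ι] [DecidableEq ι] (i : ι) :
    Differentiable ℂ fun p : (ι → ℂ) × ℂ => Function.update p.1 i p.2 := by
  rw [differentiable_pi]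
  intro j
  rcases eq_or_ne j i with rfl | hj
  · simp
  · simp only [Function.update_of_ne hj]; fun_prop

/-- An entire function vanishing on the zeros of `s (z i)`, where `s` is an entire function of one
variable with simple zeros, is divisible by `s (z i)`. -/
theorem exists_eq_mul_of_eq_zero {ι : Type*} [Fintype ι] [DecidableEq ι] (i : ι) {s : ℂ → ℂ}
    (hs : Differentiable ℂ s) (hs' : ∀ ζ, s ζ = 0 → deriv s ζ ≠ 0) {g : (ι → ℂ) → ℂ}
    (hg : Differentiable ℂ g) (h0 : ∀ z, s (z i) = 0 → g z = 0) :
    ∃ h : (ι → ℂ) → ℂ, Differentiable ℂ h ∧ ∀ z, g z = s (z i) * h z := by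
  have hgu : Differentiable ℂ fun p : (ι → ℂ) × ℂ => g (Function.update p.1 i p.2) :=
    hg.comp (differentiable_update i)
  set q : (ι → ℂ) → ℂ → ℂ := fun z ζ => if s ζ = 0
    then deriv (fun ζ => g (Function.update z i ζ)) ζ / deriv s ζ
    else g (Function.update z i ζ) / s ζ with hq
  have hqd : ∀ z, Differentiable ℂ (q z) := fun z =>
    differentiable_div_of_simple_zeros hs hs'
      (hgu.comp (f := fun ζ : ℂ => (z, ζ)) (by fun_prop)) fun ζ hζ => h0 _ (by simpa using hζ)
  refine ⟨fun z => q z (z i), fun x => ?_, fun z => ?_⟩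
  · obtain ⟨R, hR, hRs⟩ : ∃ R > 0, ∀ ζ ∈ sphere (x i) R, s ζ ≠ 0 := by
      have hev : ∀ᶠ ζ in 𝓝[≠] (x i), s ζ ≠ 0 := by
        by_cases hx : s (x i) = 0
        · exact (hs _).hasDerivAt.eventually_ne (hs' _ hx)
        · exact ((hs _).continuousAt.eventually_ne hx).filter_mono nhdsWithin_le_nhds
      rw [eventually_nhdsWithin_iff, Metric.eventually_nhds_iff] at hev
      obtain ⟨ε, hε, h⟩ := hev
      refine ⟨ε / 2, by positivity, fun ζ hζ => h ?_ ?_⟩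
      · rw [mem_sphere] at hζ; linarith
      · rintro rfl
        simp at hζ
        linarith
    have hmem : ∀ y ∈ closedBall x (R / 2), y i ∈ ball (x i) R := fun y hy => by
      rw [mem_ball]
      rw [mem_closedBall] at hy
      linarith [dist_le_pi_dist y x i]
    have hne : ∀ y ∈ closedBall x (R / 2), ∀ ζ ∈ sphere (x i) R, ζ - y i ≠ 0 :=
      fun y hy ζ hζ h => by
        have := hmem y hy
        rw [← sub_eq_zero.1 h, mem_ball, mem_sphere.1 hζ] at this
        exact lt_irrefl _ this
    have hI : DifferentiableAt ℂ (fun y => ∮ ζ in C(x i, R),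
        (ζ - y i)⁻¹ * (g (Function.update y i ζ) / s ζ)) x := by
      refine differentiableAt_circleIntegral_param_s4 (r := R / 2) (by positivity) hR.le ?_ ?_
      · refine ContinuousOn.mul (ContinuousOn.inv₀ (by fun_prop) ?_)
          (ContinuousOn.div hgu.continuous.continuousOn ?_ ?_)
        · exact fun p hp => hne p.1 hp.1 p.2 hp.2
        · exact (hs.continuous.comp continuous_snd).continuousOn
        · exact fun p hp => hRs p.2 hp.2
      · intro ζ hζ
        simp only [div_eq_mul_inv]
        refine DifferentiableOn.mul (DifferentiableOn.inv (by fun_prop) ?_)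
          (DifferentiableOn.mul_const ?_ (s ζ)⁻¹)
        · exact fun y hy => hne y (ball_subset_closedBall hy) ζ hζ
        · exact (hgu.comp (f := fun y : ι → ℂ => (y, ζ)) (by fun_prop)).differentiableOn
    refine (hI.const_mul (2 * Real.pi * I : ℂ)⁻¹).congr_of_eventuallyEq ?_
    filter_upwards [closedBall_mem_nhds x (half_pos hR)] with y hy
    have := ((hqd y).diffContOnCl (s := ball (x i) R)).two_pi_i_inv_smul_circleIntegral_sub_inv_smul
      (hmem y hy)
    rw [← this, smul_eq_mul]
    congr 1
    refine circleIntegral.integral_congr hR.le fun ζ hζ => ?_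
    simp [hq, hRs ζ hζ]
  · by_cases h : s (z i) = 0
    · simp [h, h0 z h]
    · simp [hq, h, mul_div_cancel₀]

/-- Entire functions prescribed on the hyperplanes `z i = a + w`, `w : ℤ`, have a common entire
interpolant. -/
theorem exists_differentiable_interpolating {ι : Type*} [Fintype ι] (i : ι) (a : ℂ)
    {φ : ℤ → (ι → ℂ) → ℂ} (hφ : ∀ w, Differentiable ℂ (φ w)) :
    ∃ Ψ : (ι → ℂ) → ℂ, Differentiable ℂ Ψ ∧ ∀ (w : ℤ) z, z i = a + w → Ψ z = φ w z := by
  set e : ℂ → ℂ := fun ζ => exp (2 * Real.pi * I * ζ) - 1 with he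
  have hed : Differentiable ℂ e := by fun_prop
  have he0 : deriv e 0 = 2 * Real.pi * I := by
    have : HasDerivAt e (exp (2 * Real.pi * I * 0) * (2 * Real.pi * I * 1)) 0 :=
      (((hasDerivAt_id (0 : ℂ)).const_mul _).cexp).sub_const 1
    simpa using this.deriv
  set S : ℂ → ℂ := fun ζ => dslope e 0 ζ / (2 * Real.pi * I) with hS
  have hSd : Differentiable ℂ S := by
    have : Differentiable ℂ (dslope e 0) := differentiableOn_univ.1
      ((differentiableOn_dslope univ_mem).2 hed.differentiableOn)
    exact this.div_const _
  have hS0 : S 0 = 1 := by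
    simp only [hS, dslope_same, he0]
    exact div_self two_pi_I_ne_zero
  have hSn : ∀ n : ℤ, n ≠ 0 → S n = 0 := fun n hn => by
    have h1 : e n = 0 := by
      simp only [he]
      rw [mul_comm, exp_int_mul_two_pi_mul_I, sub_self]
    have h2 : e 0 = 0 := by simp [he]
    have hn' : (n : ℂ) ≠ 0 := by exact_mod_cast hn
    simp [hS, dslope_of_ne _ hn', slope_def_field, h1, h2]
  set φ' : ℤ → (ι → ℂ) → ℂ := fun w z => φ w z * S (z i - a - w) with hφ'
  have hφ'd : ∀ w, Differentiable ℂ (φ' w) := fun w =>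
    (hφ w).mul (hSd.comp (f := fun z : ι → ℂ => z i - a - w) (by fun_prop))
  have hN : ∀ w : ℤ, ∃ n : ℕ, (w = 0 → n = 0) ∧ (w ≠ 0 → ∀ z ∈ closedBall (0 : ι → ℂ) |(w : ℝ)|,
      ‖φ' w z‖ * (1 / 2) ^ n ≤ (1 / 2 : ℝ) ^ w.natAbs) := fun w => by
    rcases eq_or_ne w 0 with rfl | hw
    · exact ⟨0, by simp⟩
    obtain ⟨M, hM⟩ := (isCompact_closedBall (0 : ι → ℂ) |(w : ℝ)|).exists_bound_of_continuousOn
      (hφ'd w).continuous.continuousOn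
    have ht : Tendsto (fun n : ℕ => M * (1 / 2 : ℝ) ^ n) atTop (𝓝 (M * 0)) :=
      (tendsto_pow_atTop_nhds_zero_of_lt_one (by norm_num) (by norm_num)).const_mul M
    rw [mul_zero] at ht
    obtain ⟨n, hn⟩ := (ht.eventually_lt_const
      (show (0 : ℝ) < (1 / 2) ^ w.natAbs by positivity)).exists
    exact ⟨n, fun h => absurd h hw, fun _ z hz =>
      (mul_le_mul_of_nonneg_right (hM z hz) (by positivity)).trans hn.le⟩
  choose N hN0 hN using hN
  set F : ℤ → (ι → ℂ) → ℂ := fun w z => φ' w z * ((z i - a) / w) ^ N w with hF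
  have hFd : ∀ w, Differentiable ℂ (F w) := fun w => (hφ'd w).mul (by fun_prop)
  refine ⟨fun z => ∑' w, F w z, differentiable_tsum_of_locally_bounded hFd fun R => ?_,
    fun w z hz => ?_⟩
  · have hM : ∀ w, ∃ M, ∀ z ∈ closedBall (0 : ι → ℂ) R, ‖F w z‖ ≤ M := fun w =>
      (isCompact_closedBall _ _).exists_bound_of_continuousOn (hFd w).continuous.continuousOn
    choose M hM using hM
    set C : ℝ := 2 * (|R| + ‖a‖) with hC
    have hC0 : 0 ≤ C := by positivity
    have hfin : {w : ℤ | ¬ C < |(w : ℝ)|}.Finite := by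
      refine (Set.finite_Icc (-⌈C⌉) ⌈C⌉).subset fun w hw => ?_
      rw [mem_ofPred_eq, not_lt, abs_le] at hw
      have := Int.le_ceil C
      constructor
      · have : (-⌈C⌉ : ℝ) ≤ w := by linarith
        exact_mod_cast this
      · have : (w : ℝ) ≤ ⌈C⌉ := by linarith
        exact_mod_cast this
    have hsum : Summable fun w : ℤ => (1 / 2 : ℝ) ^ w.natAbs := by
      apply Summable.of_nat_of_neg <;>
        simpa using summable_geometric_of_lt_one (r := (2⁻¹ : ℝ)) (by norm_num) (by norm_num)
    refine ⟨fun w => if C < |(w : ℝ)| then (1 / 2 : ℝ) ^ w.natAbs else M w, ?_, fun w z hz => ?_⟩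
    · refine hsum.congr_cofinite ?_
      refine Filter.mem_of_superset hfin.compl_mem_cofinite fun w hw => ?_
      simp only [mem_compl_iff, mem_ofPred_eq, not_not] at hw
      simp [hw]
    · dsimp only
      split_ifs with hw
      · have hw0 : 0 < |(w : ℝ)| := hC0.trans_lt hw
        have hwne : w ≠ 0 := by rintro rfl; simp at hw0
        rw [mem_ball_zero_iff] at hz
        have hzR : ‖z‖ ≤ |R| := hz.le.trans (le_abs_self R)
        have hzw : z ∈ closedBall (0 : ι → ℂ) |(w : ℝ)| := by
          rw [mem_closedBall_zero_iff]
          linarith [norm_nonneg a, norm_nonneg z]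
        refine le_trans ?_ (hN w hwne z hzw)
        simp only [hF, norm_mul, norm_pow, norm_div]
        refine mul_le_mul_of_nonneg_left (pow_le_pow_left₀ (by positivity) ?_ _) (norm_nonneg _)
        have h1 : ‖(w : ℂ)‖ = |(w : ℝ)| := by simp
        rw [h1, div_le_iff₀ hw0]
        linarith [norm_sub_le (z i) a, norm_le_pi_norm z i]
      · exact hM w z (ball_subset_closedBall hz)
  · have hother : ∀ w' ≠ w, F w' z = 0 := fun w' hw' => by
      have : S (z i - a - w') = 0 := by
        have := hSn (w - w') (sub_ne_zero.2 hw'.symm)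
        rw [hz]
        push_cast at this
        simpa using this
      simp [hF, hφ', this]
    dsimp only
    rw [tsum_eq_single w hother]
    rcases eq_or_ne w 0 with rfl | hw
    · simp [hF, hφ', hz, hN0, hS0]
    · have : (w : ℂ) ≠ 0 := by exact_mod_cast hw
      simp [hF, hφ', hz, hS0, this]

theorem exp_two_pi_I_mul_sub_eq_zero_iff {a ζ : ℂ} :
    exp (2 * Real.pi * I * ζ) - exp (2 * Real.pi * I * a) = 0 ↔ ∃ w : ℤ, ζ = a + w := by
  rw [sub_eq_zero, exp_eq_exp_iff_exists_int]
  refine exists_congr fun w => ?_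
  rw [show 2 * Real.pi * I * a + w * (2 * Real.pi * I) = 2 * Real.pi * I * (a + w) by ring,
    mul_right_inj' two_pi_I_ne_zero]

/-- An entire function vanishing wherever the coordinates in `S` lie in `α + ℤ` is in the ideal
generated by the functions `exp (2πi z i) - exp (2πi α i)`, `i ∈ S`. -/
theorem exists_eq_sum_of_eq_zero_on_lattice {ι : Type*} [Fintype ι] [DecidableEq ι]
    (α : ι → ℂ) (S : Finset ι) (g : (ι → ℂ) → ℂ) (hg : Differentiable ℂ g)
    (h0 : ∀ z, (∀ i ∈ S, ∃ w : ℤ, z i = α i + w) → g z = 0) :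
    ∃ ψ : ι → (ι → ℂ) → ℂ, (∀ i, Differentiable ℂ (ψ i)) ∧ ∀ z, g z =
      ∑ i ∈ S, (exp (2 * Real.pi * I * z i) - exp (2 * Real.pi * I * α i)) * ψ i z := by
  induction S using Finset.induction_on generalizing g with
  | empty => exact ⟨fun _ _ => 0, fun _ => differentiable_const _, fun z => by simp [h0 z]⟩
  | insert i S hi ih =>
    have hupd : ∀ c : ℂ, Differentiable ℂ fun z : ι → ℂ => Function.update z i c := fun c =>
      (differentiable_update i).comp (f := fun z : ι → ℂ => (z, c)) (by fun_prop)
    have hψ := fun w : ℤ => ih (fun z => g (Function.update z i (α i + w))) (hg.comp (hupd _))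
      fun z hz => h0 _ fun j hj => by
        rcases eq_or_ne j i with rfl | hji
        · exact ⟨w, by simp⟩
        · simpa [hji] using hz j (Finset.mem_of_mem_insert_of_ne hj hji)
    choose φ hφd hφ using hψ
    choose Ψ hΨd hΨ using fun j =>
      exists_differentiable_interpolating i (α i) (φ := fun w => φ w j) fun w => hφd w j
    have hsd : Differentiable ℂ fun ζ : ℂ =>
        exp (2 * Real.pi * I * ζ) - exp (2 * Real.pi * I * α i) := by fun_prop
    obtain ⟨h, hd, hh⟩ := exists_eq_mul_of_eq_zero i
      (s := fun ζ => exp (2 * Real.pi * I * ζ) - exp (2 * Real.pi * I * α i)) hsd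
      (fun ζ _ => by
        have : HasDerivAt (fun ζ : ℂ => exp (2 * Real.pi * I * ζ) - exp (2 * Real.pi * I * α i))
            (exp (2 * Real.pi * I * ζ) * (2 * Real.pi * I * 1)) ζ :=
          (((hasDerivAt_id ζ).const_mul _).cexp).sub_const _
        rw [this.deriv, mul_one]
        exact mul_ne_zero (exp_ne_zero _) two_pi_I_ne_zero)
      (g := fun z => g z - ∑ j ∈ S,
        (exp (2 * Real.pi * I * z j) - exp (2 * Real.pi * I * α j)) * Ψ j z)
      (by fun_prop)
      (fun z hz => by
        obtain ⟨w, hw⟩ := exp_two_pi_I_mul_sub_eq_zero_iff.1 hz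
        have := hφ w z
        rw [← hw, Function.update_eq_self] at this
        rw [this, sub_eq_zero]
        exact Finset.sum_congr rfl fun j _ => by rw [hΨ j w z hw])
    refine ⟨Function.update Ψ i h, fun j => ?_, fun z => ?_⟩
    · rcases eq_or_ne j i with rfl | hji
      · simpa using hd
      · simpa [hji] using hΨd j
    · have hsum : ∀ j ∈ S, (exp (2 * Real.pi * I * z j) - exp (2 * Real.pi * I * α j)) *
          Function.update Ψ i h j z =
          (exp (2 * Real.pi * I * z j) - exp (2 * Real.pi * I * α j)) * Ψ j z := fun j hj => by
        rw [Function.update_of_ne (ne_of_mem_of_not_mem hj hi)]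
      rw [Finset.sum_insert hi, Function.update_self, ← hh z, Finset.sum_congr rfl hsum]
      ring

theorem eq_of_forall_dvd_sub {κ β : Type*} [Fintype κ] [DecidableEq κ] {l : ℤ}
    {P : (κ → ℤ) → β} (hP : ∀ v i, P (v + Pi.single i l) = P v) {u v : κ → ℤ}
    (huv : ∀ i, l ∣ v i - u i) : P v = P u := by
  let H : AddSubgroup (κ → ℤ) :=
    { carrier := {u | ∀ v, P (v + u) = P v}
      zero_mem' := fun v => by rw [add_zero]
      add_mem' := fun {a b} ha hb v => by rw [← add_assoc, hb, ha]
      neg_mem' := fun {a} ha v => by rw [← ha (v + -a), neg_add_cancel_right] }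
  choose t ht using huv
  have hmem : ∑ i, t i • (Pi.single i l : κ → ℤ) ∈ H :=
    H.sum_mem fun i _ => H.zsmul_mem (fun v => hP v i) _
  have hv : v = u + ∑ i, t i • (Pi.single i l : κ → ℤ) := by
    ext j
    simp only [Pi.add_apply, Finset.sum_apply, Pi.smul_apply, Pi.single_apply, smul_eq_mul,
      mul_ite, mul_zero, Finset.sum_ite_eq, Finset.mem_univ, if_true]
    linarith [ht j, mul_comm l (t j)]
  rw [hv]
  exact hmem u

theorem sum_exp_two_pi_I_div_mul {l : ℕ} (hl : l ≠ 0) (w : ℤ) :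
    ∑ k : Fin l, exp (2 * Real.pi * I / l * (((k : ℕ) : ℂ) * w)) =
      if (l : ℤ) ∣ w then (l : ℂ) else 0 := by
  have hprim := isPrimitiveRoot_exp l hl
  set x := exp (2 * Real.pi * I / l) ^ w with hx
  have hk : ∀ k : Fin l, exp (2 * Real.pi * I / l * (((k : ℕ) : ℂ) * w)) = x ^ (k : ℕ) := by
    intro k
    rw [hx, ← exp_int_mul, ← exp_nat_mul]
    congr 1
    ring
  rw [Finset.sum_congr rfl fun k _ => hk k, Fin.sum_univ_eq_sum_range (fun k => x ^ k)]
  split_ifs with h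
  · simp [hx, (hprim.zpow_eq_one_iff_dvd w).2 h]
  · have hx1 : x ≠ 1 := fun h1 => h ((hprim.zpow_eq_one_iff_dvd w).1 h1)
    have hxl : x ^ l = 1 := by
      rw [hx, ← zpow_natCast, zpow_comm, zpow_natCast, hprim.pow_eq_one, one_zpow]
    rw [geom_sum_eq hx1, hxl, sub_self, zero_div]

theorem sum_pi_exp_two_pi_I_div_mul {κ : Type*} [Fintype κ] [DecidableEq κ] {l : ℕ} (hl : l ≠ 0)
    (w : κ → ℤ) :
    ∑ k : κ → Fin l, exp (2 * Real.pi * I / l * ∑ i, ((k i : ℕ) : ℂ) * w i) =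
      if ∀ i, (l : ℤ) ∣ w i then (l : ℂ) ^ Fintype.card κ else 0 := by
  simp_rw [Finset.mul_sum, exp_sum]
  rw [← Fintype.prod_sum fun i (k : Fin l) => exp (2 * Real.pi * I / l * (((k : ℕ) : ℂ) * w i))]
  simp_rw [sum_exp_two_pi_I_div_mul hl]
  split_ifs with h
  · simp [h]
  · push Not at h
    obtain ⟨i, hi⟩ := h
    exact Finset.prod_eq_zero (Finset.mem_univ i) (if_neg hi)

/-- Discrete Fourier inversion for an `l`-periodic function on a coset of `ℤ^κ`. -/
theorem sum_discrete_fourier_eq {κ : Type*} [Fintype κ] [DecidableEq κ] {l : ℕ} (hl : l ≠ 0)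
    {P : (κ → ℤ) → ℂ} (hP : ∀ v i, P (v + Pi.single i (l : ℤ)) = P v) (α : κ → ℂ) (w : κ → ℤ) :
    ∑ k : κ → Fin l, ((1 / (l : ℂ) ^ Fintype.card κ) * ∑ j : κ → Fin l,
        exp (-(2 * Real.pi * I / l) * ∑ i, ((k i : ℕ) : ℂ) * (α i + ((j i : ℕ) : ℂ))) *
          P fun i => ((j i : ℕ) : ℤ)) *
      exp (2 * Real.pi * I / l * ∑ i, ((k i : ℕ) : ℂ) * (α i + w i)) = P w := by
  have hl' : (l : ℂ) ≠ 0 := by exact_mod_cast hl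
  have hlz : (l : ℤ) ≠ 0 := by exact_mod_cast hl
  have hnn : ∀ i, 0 ≤ w i % l := fun i => Int.emod_nonneg _ hlz
  let r : κ → Fin l := fun i => ⟨(w i % l).toNat, by
    have := Int.emod_lt_of_pos (w i) (show (0 : ℤ) < l by omega)
    have := hnn i
    omega⟩
  have hr : ∀ i, ((r i : ℕ) : ℤ) = w i % l := fun i => Int.toNat_of_nonneg (hnn i)
  have hiff : ∀ j : κ → Fin l, (∀ i, (l : ℤ) ∣ w i - ((j i : ℕ) : ℤ)) ↔ j = r := fun j => by
    rw [funext_iff]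
    refine forall_congr' fun i => ?_
    rw [← Int.modEq_iff_dvd, Int.ModEq, Fin.ext_iff, ← hr i,
      Int.emod_eq_of_lt (by positivity) (by exact_mod_cast (j i).isLt), Nat.cast_inj]
  calc _ = ∑ k : κ → Fin l, ∑ j : κ → Fin l, (1 / (l : ℂ) ^ Fintype.card κ) *
        (P fun i => ((j i : ℕ) : ℤ)) *
        exp (2 * Real.pi * I / l * ∑ i, ((k i : ℕ) : ℂ) * ((w i - ((j i : ℕ) : ℤ) : ℤ) : ℂ)) := by
        refine Finset.sum_congr rfl fun k _ => ?_
        rw [Finset.mul_sum, Finset.sum_mul]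
        refine Finset.sum_congr rfl fun j _ => ?_
        have : exp (2 * Real.pi * I / l *
            ∑ i, ((k i : ℕ) : ℂ) * ((w i - ((j i : ℕ) : ℤ) : ℤ) : ℂ)) =
            exp (-(2 * Real.pi * I / l) * ∑ i, ((k i : ℕ) : ℂ) * (α i + ((j i : ℕ) : ℂ))) *
            exp (2 * Real.pi * I / l * ∑ i, ((k i : ℕ) : ℂ) * (α i + w i)) := by
          rw [← exp_add, neg_mul, neg_add_eq_sub, ← mul_sub, ← Finset.sum_sub_distrib]
          congr 2
          refine Finset.sum_congr rfl fun i _ => ?_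
          push_cast
          ring
        rw [this]
        ring
    _ = ∑ j : κ → Fin l, (1 / (l : ℂ) ^ Fintype.card κ) * (P fun i => ((j i : ℕ) : ℤ)) *
        if j = r then (l : ℂ) ^ Fintype.card κ else 0 := by
        rw [Finset.sum_comm]
        refine Finset.sum_congr rfl fun j _ => ?_
        rw [← Finset.mul_sum, sum_pi_exp_two_pi_I_div_mul hl fun i => w i - ((j i : ℕ) : ℤ)]
        simp only [hiff]
    _ = P fun i => ((r i : ℕ) : ℤ) := by
        simp only [mul_ite, mul_zero, Finset.sum_ite_eq', Finset.mem_univ, if_true]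
        field_simp
    _ = P w := (eq_of_forall_dvd_sub hP ((hiff r).2 rfl)).symm


/-- A function `f : ℂ^n → ℂ` (with `n = m + p`) that is entire and
`ℓ`-periodic in its first `m` variables on the shifted lattice agrees with its
discrete Fourier transform modulo the lattice ideal `I_α`. -/
theorem periodic_eq_fourier_mod_ideal (ℓ m p : ℕ) (hℓ : 1 ≤ ℓ) (hm : 1 ≤ m)
    (α : Fin (m + p) → ℂ) (f : (Fin (m + p) → ℂ) → ℂ) (hf : Differentiable ℂ f)
    (hper : ∀ z : Fin (m + p) → ℂ,
      (∀ j : Fin m, ∃ w : ℤ, z (Fin.castAdd p j) - α (Fin.castAdd p j) = (w : ℂ)) →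
      ∀ i : Fin m, f (z + (ℓ : ℂ) • (Pi.single (Fin.castAdd p i) (1 : ℂ) : Fin (m + p) → ℂ)) = f z)
    (a : (Fin m → Fin ℓ) → (Fin p → ℂ) → ℂ)
    (ha : ∀ (k : Fin m → Fin ℓ) (z' : Fin p → ℂ),
      a k z' = (1 / (ℓ : ℂ) ^ m) *
        ∑ j : Fin m → Fin ℓ,
          Complex.exp (-(2 * (Real.pi : ℂ) * Complex.I / (ℓ : ℂ)) *
            ∑ i : Fin m, ((k i : ℕ) : ℂ) * (α (Fin.castAdd p i) + ((j i : ℕ) : ℂ))) *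
          f (Fin.append (fun i => α (Fin.castAdd p i) + ((j i : ℕ) : ℂ)) z')) :
    ∃ ψ : Fin (m + p) → ((Fin (m + p) → ℂ) → ℂ), (∀ i, Differentiable ℂ (ψ i)) ∧
      ∀ z : Fin (m + p) → ℂ,
        f z - (∑ k : Fin m → Fin ℓ,
          a k (fun i => z (Fin.natAdd m i)) *
          Complex.exp ((2 * (Real.pi : ℂ) * Complex.I / (ℓ : ℂ)) *
            ∑ i : Fin m, ((k i : ℕ) : ℂ) * z (Fin.castAdd p i))) =
        ∑ i : Fin (m + p),
          (Complex.exp (2 * (Real.pi : ℂ) * Complex.I * z i) -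
            Complex.exp (2 * (Real.pi : ℂ) * Complex.I * α i)) * ψ i z := by
  have happ : ∀ (x : Fin m → ℂ), Differentiable ℂ fun z : Fin (m + p) → ℂ =>
      Fin.append x fun i => z (Fin.natAdd m i) := fun x => by
    rw [differentiable_pi]
    intro j
    induction j using Fin.addCases <;> simp only [Fin.append_left, Fin.append_right] <;> fun_prop
  have had : ∀ k, Differentiable ℂ fun z : Fin (m + p) → ℂ =>
      a k (fun i => z (Fin.natAdd m i)) := fun k => by
    simp only [ha]
    exact (Differentiable.fun_sum fun j _ => (hf.comp (happ _)).const_mul _).const_mul _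
  have hvan : ∀ z : Fin (m + p) → ℂ,
      (∀ i ∈ Finset.univ.map (Fin.castAddEmb p), ∃ w : ℤ, z i = α i + w) →
      f z - ∑ k : Fin m → Fin ℓ, a k (fun i => z (Fin.natAdd m i)) *
        exp ((2 * (Real.pi : ℂ) * I / (ℓ : ℂ)) *
          ∑ i : Fin m, ((k i : ℕ) : ℂ) * z (Fin.castAdd p i)) = 0 := by
    intro z hz
    have hz' : ∀ i : Fin m, ∃ w : ℤ, z (Fin.castAdd p i) = α (Fin.castAdd p i) + w :=
      fun i => hz _ (by simp)
    choose w hw using hz'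
    set P : (Fin m → ℤ) → ℂ := fun v =>
      f (Fin.append (fun i => α (Fin.castAdd p i) + v i) fun i => z (Fin.natAdd m i)) with hP
    have hPp : ∀ v i, P (v + Pi.single i (ℓ : ℤ)) = P v := fun v i => by
      simp only [hP]
      rw [← hper (Fin.append (fun i => α (Fin.castAdd p i) + v i) fun i => z (Fin.natAdd m i))
        (fun j => ⟨v j, by simp⟩) i]
      congr 1
      ext j
      induction j using Fin.addCases with
      | left j =>
        rcases eq_or_ne j i with rfl | hji
        · simp [add_assoc]
        · simp [hji]
      | right j =>
        have : Fin.natAdd m j ≠ Fin.castAdd p i := by simp [Fin.ext_iff]; omega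
        simp [this]
    have hPw : P w = f z := by
      simp only [hP, ← hw]
      congr 1
      exact Fin.append_castAdd_natAdd
    have key := sum_discrete_fourier_eq (by omega : ℓ ≠ 0) hPp (fun i => α (Fin.castAdd p i)) w
    rw [sub_eq_zero, ← hPw, ← key]
    simp only [hP, ha, hw, Fintype.card_fin, Int.cast_natCast]
  obtain ⟨ψ, hψd, hψ⟩ := exists_eq_sum_of_eq_zero_on_lattice α
    (Finset.univ.map (Fin.castAddEmb p))
    (fun z => f z - ∑ k : Fin m → Fin ℓ, a k (fun i => z (Fin.natAdd m i)) *
      exp ((2 * (Real.pi : ℂ) * I / (ℓ : ℂ)) *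
        ∑ i : Fin m, ((k i : ℕ) : ℂ) * z (Fin.castAdd p i)))
    (hf.sub (Differentiable.fun_sum fun k _ => (had k).mul (by fun_prop))) hvan
  refine ⟨fun i => if i ∈ Finset.univ.map (Fin.castAddEmb p) then ψ i else 0, fun i => ?_,
    fun z => ?_⟩
  · dsimp only
    split_ifs
    exacts [hψd i, differentiable_const 0]
  · rw [hψ z, ← Finset.sum_subset (Finset.subset_univ (Finset.univ.map (Fin.castAddEmb p)))
      fun i _ hi => by simp only [if_neg hi, Pi.zero_apply, mul_zero]]
    exact Finset.sum_congr rfl fun i hi => by simp only [if_pos hi]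
end

section
/- (Reduction of a power-quadratic element to a power-linear element modulo the lattice ideal.) Let ℓ ≥ 1 and n ≥ 1 be integers, let c = (c_{st}) be an n×n matrix of integers, define q : ℂ^n → ℂ by q(z) = Σ_{s,t=1}^{n} c_{st}·z_s·z_t, let α ∈ ℂ^n, and define l : ℂ^n → ℂ by l(z) = q(α + z) − q(α) − q(z). Then there exist complex numbers a_k for k ∈ {0, 1, …, ℓ−1}^n and entire functions ψ₁, …, ψ_n : ℂ^n → ℂ such that for all z ∈ ℂ^n: exp((2πi/ℓ)·q(z)) = exp((2πi/ℓ)·l(z)) · Σ_{k ∈ {0,…,ℓ−1}^n} a_k · exp((2πi/ℓ)·Σ_{i=1}^{n} k_i z_i) + Σ_{i=1}^{n} (exp(2πi·z_i) − exp(2πi·α_i))·ψ_i(z). In other words, exp((2πi/ℓ)·q) lies in exp((2πi/ℓ)·l)·ℂ[exp((2πi/ℓ)z₁), …, exp((2πi/ℓ)z_n)] modulo the ideal I_α. -/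
/-- A linear exponential weight is beaten by a Gaussian in a series over `ℤ`. -/
theorem summable_exp_linear_sub_sq (D C : ℝ) :
    Summable fun j : ℤ => Real.exp (D + C * |(j : ℝ)| - (j : ℝ) ^ 2) := by
  have h : Summable fun j : ℤ => Real.exp (D + (C + 1) ^ 2) * Real.exp (-|(j : ℝ)|) := by
    refine Summable.mul_left _ (Summable.of_nat_of_neg ?_ ?_) <;>
      simpa using Real.summable_exp_neg_nat
  refine Summable.of_nonneg_of_le (fun _ => (Real.exp_pos _).le) (fun j => ?_) h
  rw [← Real.exp_add, Real.exp_le_exp, ← sq_abs (j : ℝ)]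
  nlinarith [sq_nonneg (|(j : ℝ)| - (C + 1) / 2), sq_nonneg (C + 1)]

/-- Cauchy's estimate for the total derivative of an entire function. -/
theorem norm_fderiv_le_of_forall_mem_ball {E : Type*} [NormedAddCommGroup E] [NormedSpace ℂ E]
    {f : E → ℂ} (hf : Differentiable ℂ f) {x : E} {C : ℝ} (hC : 0 ≤ C)
    (h : ∀ y, ‖y - x‖ ≤ 1 → ‖f y‖ ≤ C) : ‖fderiv ℂ f x‖ ≤ C := by
  refine ContinuousLinearMap.opNorm_le_of_unit_norm hC fun u hu => ?_
  have hline : HasDerivAt (fun t : ℂ => x + t • u) u 0 := by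
    simpa using ((hasDerivAt_id (0 : ℂ)).smul_const u).const_add x
  have hcomp : HasDerivAt (fun t : ℂ => f (x + t • u)) (fderiv ℂ f x u) 0 :=
    HasFDerivAt.comp_hasDerivAt_of_eq (0 : ℂ) (hf x).hasFDerivAt hline (by simp)
  have hd : Differentiable ℂ fun t : ℂ => f (x + t • u) := by fun_prop
  rw [← hcomp.deriv]
  simpa using Complex.norm_deriv_le_of_forall_mem_sphere_norm_le one_pos hd.diffContOnCl
    fun t ht => h (x + t • u) (by simpa [norm_smul, hu] using (mem_sphere_zero_iff_norm.mp ht).le)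

theorem differentiable_tsum_of_gaussian_bound {E : Type*} [NormedAddCommGroup E] [NormedSpace ℂ E]
    {f : ℤ → E → ℂ} (hf : ∀ j, Differentiable ℂ (f j))
    (hb : ∀ R : ℝ, ∃ D C : ℝ, ∀ x, ‖x‖ ≤ R → ∀ j : ℤ,
      ‖f j x‖ ≤ Real.exp (D + C * |(j : ℝ)| - (j : ℝ) ^ 2)) :
    (∀ x, Summable fun j => f j x) ∧ Differentiable ℂ fun x => ∑' j, f j x := by
  have hs : ∀ x, Summable fun j => f j x := fun x => by
    obtain ⟨D, C, h⟩ := hb ‖x‖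
    exact Summable.of_norm_bounded (summable_exp_linear_sub_sq D C) (h x le_rfl)
  refine ⟨hs, fun x => ?_⟩
  obtain ⟨D, C, h⟩ := hb (‖x‖ + 2)
  let _ : NormedSpace ℝ E := NormedSpace.restrictScalars ℝ ℂ E
  refine (hasFDerivAt_tsum_of_isPreconnected (s := Metric.ball x 1) (x₀ := x) (x := x)
    (summable_exp_linear_sub_sq D C) Metric.isOpen_ball
    (convex_ball x 1).isPreconnected (fun j y _ => (hf j y).hasFDerivAt) (fun j y hy => ?_)
    (Metric.mem_ball_self one_pos) (hs x) (Metric.mem_ball_self one_pos)).differentiableAt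
  refine norm_fderiv_le_of_forall_mem_ball (hf j) (Real.exp_pos _).le fun w hw => h w ?_ j
  have h₁ : ‖y - x‖ < 1 := mem_ball_iff_norm.mp hy
  calc ‖w‖ = ‖(w - y) + (y - x) + x‖ := by congr 1; abel
    _ ≤ ‖w - y‖ + ‖y - x‖ + ‖x‖ := norm_add₃_le
    _ ≤ ‖x‖ + 2 := by linarith

/-- An entire function vanishing at the zeros of an entire function with simple zeros
is divisible by it. -/
theorem exists_entire_quotient {f h : ℂ → ℂ} (hf : Differentiable ℂ f) (hh : Differentiable ℂ h)
    (hsimple : ∀ w, h w = 0 → deriv h w ≠ 0) (hzero : ∀ w, h w = 0 → f w = 0) :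
    ∃ r : ℂ → ℂ, Differentiable ℂ r ∧ ∀ w, f w = h w * r w := by
  classical
  refine ⟨fun w => if h w = 0 then deriv f w / deriv h w else f w / h w, fun a => ?_, fun w => ?_⟩
  · by_cases ha : h a = 0
    · have hdf := ((Complex.differentiableOn_dslope (c := a) Filter.univ_mem).mpr
        hf.differentiableOn).differentiableAt (x := a) Filter.univ_mem
      have hdh := ((Complex.differentiableOn_dslope (c := a) Filter.univ_mem).mpr
        hh.differentiableOn).differentiableAt (x := a) Filter.univ_mem
      have hne : dslope h a a ≠ 0 := by simpa using hsimple a ha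
      refine (hdf.div hdh hne).congr_of_eventuallyEq ?_
      filter_upwards [hdh.continuousAt.eventually_ne hne] with w hw
      rcases eq_or_ne w a with rfl | hwa
      · simp [ha]
      · have h₁ := sub_smul_dslope_of_zero (hzero a ha) w
        have h₂ := sub_smul_dslope_of_zero ha w
        have hwa' : w - a ≠ 0 := sub_ne_zero.mpr hwa
        have h₃ : h w ≠ 0 := by
          rw [← h₂, smul_eq_mul]; exact mul_ne_zero hwa' hw
        simp only [h₃, if_false, Pi.div_apply]
        rw [← h₁, ← h₂, smul_eq_mul, smul_eq_mul, mul_div_mul_left _ _ hwa']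
    · refine ((hf a).div (hh a) ha).congr_of_eventuallyEq ?_
      filter_upwards [(hh a).continuousAt.eventually_ne ha] with w hw
      simp [hw]
  · by_cases hw : h w = 0
    · simp [hw, hzero w hw]
    · simp only [hw, if_false]; field_simp

/-- The entire function `(exp x - 1) / x`. -/
theorem exists_entire_exp_sub_one_div : ∃ E : ℂ → ℂ, Differentiable ℂ E ∧
    (∀ x, Complex.exp x - 1 = x * E x) ∧ E 0 = 1 ∧ ∀ x, ‖E x‖ ≤ Real.exp ‖x‖ := by
  have hE : ∀ x, Complex.exp x - 1 = x * dslope Complex.exp 0 x := fun x => by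
    simpa using (sub_smul_dslope Complex.exp 0 x).symm
  refine ⟨dslope Complex.exp 0, ?_, hE, by simp, fun x => ?_⟩
  · rw [← differentiableOn_univ, Complex.differentiableOn_dslope Filter.univ_mem]
    exact Complex.differentiable_exp.differentiableOn
  · rcases eq_or_ne x 0 with rfl | hx
    · simp
    · have h := Complex.norm_exp_sub_sum_le_norm_mul_exp x 1
      simp only [Finset.range_one, Finset.sum_singleton, pow_zero, Nat.factorial_zero,
        Nat.cast_one, div_one, pow_one, hE, norm_mul] at h
      exact le_of_mul_le_mul_left h (norm_pos_iff.mpr hx)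

/-- The Laurent polynomials `(e(jv) - 1) / (e(v) - 1)`, where `e(v) = exp (2πiv)`. -/
theorem exists_entire_exp_int_quotient (j : ℤ) : ∃ p : ℂ → ℂ, Differentiable ℂ p ∧
    (∀ v, Complex.exp (2 * (Real.pi : ℂ) * Complex.I * (j * v)) - 1 =
      (Complex.exp (2 * (Real.pi : ℂ) * Complex.I * v) - 1) * p v) ∧
    ∀ v, ‖p v‖ ≤ Real.exp (2 * Real.pi * ‖v‖ * (|(j : ℝ)| + 1) + |(j : ℝ)|) := by
  have hnorm : ∀ v : ℂ, ‖2 * (Real.pi : ℂ) * Complex.I * v‖ = 2 * Real.pi * ‖v‖ := fun v => by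
    simp [abs_of_pos Real.pi_pos]
  have hgeom : ∀ (m : ℕ) (v : ℂ),
      ‖∑ i ∈ Finset.range m, Complex.exp (2 * (Real.pi : ℂ) * Complex.I * v) ^ i‖ ≤
        Real.exp (2 * Real.pi * ‖v‖ * m + m) := fun m v => by
    have h1 : ∀ i ∈ Finset.range m, ‖Complex.exp (2 * (Real.pi : ℂ) * Complex.I * v) ^ i‖ ≤
        Real.exp (2 * Real.pi * ‖v‖ * m) := fun i hi => by
      rw [← Complex.exp_nat_mul]
      refine (Complex.norm_exp_le_exp_norm _).trans (Real.exp_le_exp.mpr ?_)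
      rw [norm_mul, hnorm, Complex.norm_natCast, mul_comm]
      have : (i : ℝ) ≤ m := by exact_mod_cast (Finset.mem_range.mp hi).le
      have := Real.pi_pos
      gcongr
    refine (norm_sum_le_of_le _ h1).trans ?_
    rw [Finset.sum_const, Finset.card_range, nsmul_eq_mul, Real.exp_add, mul_comm]
    gcongr
    linarith [Real.add_one_le_exp (m : ℝ)]
  obtain ⟨m, rfl | rfl⟩ := j.eq_nat_or_neg
  · refine ⟨fun v => ∑ i ∈ Finset.range m, Complex.exp (2 * (Real.pi : ℂ) * Complex.I * v) ^ i,
      by fun_prop, fun v => ?_, fun v => (hgeom m v).trans (Real.exp_le_exp.mpr ?_)⟩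
    · beta_reduce
      rw [mul_comm (_ - 1), geom_sum_mul, ← Complex.exp_nat_mul]
      push_cast; ring_nf
    · have := Real.pi_pos
      have : 0 ≤ 2 * Real.pi * ‖v‖ := by positivity
      simp; linarith
  · refine ⟨fun v => -Complex.exp (2 * (Real.pi : ℂ) * Complex.I * (-v)) *
      ∑ i ∈ Finset.range m, Complex.exp (2 * (Real.pi : ℂ) * Complex.I * (-v)) ^ i,
      by fun_prop, fun v => ?_, fun v => ?_⟩
    · have h1 := geom_sum_mul (Complex.exp (2 * (Real.pi : ℂ) * Complex.I * (-v))) m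
      have h2 : Complex.exp (2 * (Real.pi : ℂ) * Complex.I * v) *
          Complex.exp (2 * (Real.pi : ℂ) * Complex.I * (-v)) = 1 := by
        rw [← Complex.exp_add]; simp
      rw [← Complex.exp_nat_mul] at h1
      have h3 : 2 * (Real.pi : ℂ) * Complex.I * (((-(m : ℤ) : ℤ) : ℂ) * v) =
        m * (2 * (Real.pi : ℂ) * Complex.I * (-v)) := by push_cast; ring
      rw [h3, ← h1]
      linear_combination (∑ i ∈ Finset.range m,
        Complex.exp (2 * (Real.pi : ℂ) * Complex.I * (-v)) ^ i) * h2
    · have h1 := hgeom m (-v)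
      have h2 := Complex.norm_exp_le_exp_norm (2 * (Real.pi : ℂ) * Complex.I * (-v))
      rw [hnorm] at h2
      rw [norm_mul, norm_neg]
      refine (mul_le_mul h2 h1 (norm_nonneg _) (Real.exp_pos _).le).trans ?_
      rw [← Real.exp_add, Real.exp_le_exp]
      simp; linarith

theorem norm_exp_neg_sub_int_sq_le {R : ℝ} {w : ℂ} (hw : ‖w‖ ≤ R) (j : ℤ) :
    ‖Complex.exp (-(w - j) ^ 2)‖ ≤ Real.exp (R ^ 2 + 2 * R * |(j : ℝ)| - (j : ℝ) ^ 2) := by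
  rw [Complex.norm_exp, Real.exp_le_exp]
  have h1 : (-(w - j) ^ 2).re = w.im ^ 2 - w.re ^ 2 + 2 * (w.re * j) - (j : ℝ) ^ 2 := by
    simp [pow_two]; ring
  have h2 : w.im ^ 2 ≤ R ^ 2 := sq_le_sq' (by linarith [neg_abs_le w.im, Complex.abs_im_le_norm w])
    ((le_abs_self _).trans ((Complex.abs_im_le_norm w).trans hw))
  have h3 : w.re * j ≤ R * |(j : ℝ)| := by
    refine (le_abs_self _).trans ?_
    rw [abs_mul]
    exact mul_le_mul_of_nonneg_right ((Complex.abs_re_le_norm w).trans hw) (abs_nonneg _)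
  rw [h1]
  nlinarith [sq_nonneg w.re]

/-- With `e(x) = exp (2πix)`, the entire function `e(vw) - 1` of two variables lies in the ideal
generated by `e(v) - 1` and `e(w) - 1`. -/
theorem exists_entire_exp_mul_sub_one : ∃ A B : ℂ × ℂ → ℂ, Differentiable ℂ A ∧
    Differentiable ℂ B ∧ ∀ v w : ℂ,
      Complex.exp (2 * (Real.pi : ℂ) * Complex.I * (v * w)) - 1 =
        (Complex.exp (2 * (Real.pi : ℂ) * Complex.I * v) - 1) * A (v, w) +
        (Complex.exp (2 * (Real.pi : ℂ) * Complex.I * w) - 1) * B (v, w) := by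
  obtain ⟨E, hEd, hE, hE0, hEb⟩ := exists_entire_exp_sub_one_div
  choose p hpd hp hpb using exists_entire_exp_int_quotient
  set c : ℂ := 2 * (Real.pi : ℂ) * Complex.I with hc
  have hc0 : c ≠ 0 := Complex.two_pi_I_ne_zero
  have hcn : ‖c‖ = 2 * Real.pi := by simp [hc, abs_of_pos Real.pi_pos]
  have hpi := Real.pi_pos
  have hint : ∀ j : ℤ, Complex.exp (c * j) = 1 := fun j =>
    Complex.exp_eq_one_iff.mpr ⟨j, by rw [mul_comm]⟩
  have hsub : ∀ (w : ℂ) (j : ℤ) (R : ℝ), ‖w‖ ≤ R → ‖w - j‖ ≤ R + |(j : ℝ)| := fun w j R hw =>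
    (norm_sub_le _ _).trans (by simpa using hw)
  let g : ℤ → ℂ → ℂ := fun j w => Complex.exp (-(w - j) ^ 2) * E (c * (w - j))
  have hgd : ∀ j, Differentiable ℂ (g j) := fun j => by simp only [g]; fun_prop
  have hgb : ∀ (R : ℝ) (w : ℂ), ‖w‖ ≤ R → ∀ j : ℤ, ‖g j w‖ ≤
      Real.exp ((R ^ 2 + 2 * Real.pi * R) + (2 * R + 2 * Real.pi) * |(j : ℝ)| - (j : ℝ) ^ 2) := by
    intro R w hw j
    have h2 : ‖E (c * (w - j))‖ ≤ Real.exp (2 * Real.pi * (R + |(j : ℝ)|)) := by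
      refine (hEb _).trans (Real.exp_le_exp.mpr ?_)
      rw [norm_mul, hcn]
      gcongr
      exact hsub w j R hw
    simp only [g, norm_mul]
    refine (mul_le_mul (norm_exp_neg_sub_int_sq_le hw j) h2 (norm_nonneg _)
      (Real.exp_pos _).le).trans (le_of_eq ?_)
    rw [← Real.exp_add]; ring_nf
  obtain ⟨hΘs, hΘd⟩ := differentiable_tsum_of_gaussian_bound hgd fun R => ⟨_, _, hgb R⟩
  set Θ : ℂ → ℂ := fun w => ∑' j, g j w with hΘ
  have hΘint : ∀ k : ℤ, Θ k = 1 := fun k => by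
    have h : ∀ j, j ≠ k → g j k = 0 := fun j hj => by
      have hne : c * ((k : ℂ) - j) ≠ 0 :=
        mul_ne_zero hc0 (sub_ne_zero.mpr (by exact_mod_cast hj.symm))
      have h0 := hE (c * ((k : ℂ) - j))
      rw [← Int.cast_sub, hint, sub_self, Int.cast_sub] at h0
      simp [g, (mul_eq_zero.mp h0.symm).resolve_left hne]
    simp only [hΘ]
    rw [tsum_eq_single k h]
    simp [g, hE0]
  have hder : ∀ w, HasDerivAt (fun w => Complex.exp (c * w) - 1) (Complex.exp (c * w) * c) w :=
    fun w => by simpa using ((hasDerivAt_id w).const_mul c).cexp.sub_const 1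
  obtain ⟨r, hrd, hr⟩ := exists_entire_quotient (f := fun w => Θ w - 1)
    (h := fun w => Complex.exp (c * w) - 1) (hΘd.sub_const 1) (by fun_prop)
    (fun w _ => by rw [(hder w).deriv]; exact mul_ne_zero (Complex.exp_ne_zero _) hc0)
    (fun w hw => by
      obtain ⟨k, hk⟩ := Complex.exp_eq_one_iff.mp (sub_eq_zero.mp hw)
      have : w = k := mul_left_cancel₀ hc0 (by rw [hk, mul_comm])
      rw [this, hΘint, sub_self])
  obtain ⟨hAs, hAd⟩ := differentiable_tsum_of_gaussian_bound
    (f := fun j (x : ℂ × ℂ) => p j x.1 * g j x.2)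
    (fun j => ((hpd j).comp differentiable_fst).mul ((hgd j).comp differentiable_snd))
    fun R => ⟨R ^ 2 + 4 * Real.pi * R, 2 * R + 2 * Real.pi + 2 * Real.pi * R + 1,
      fun x hx j => by
        have h1 : ‖p j x.1‖ ≤ Real.exp (2 * Real.pi * R * (|(j : ℝ)| + 1) + |(j : ℝ)|) := by
          refine (hpb j x.1).trans (Real.exp_le_exp.mpr ?_)
          gcongr
          exact (norm_fst_le x).trans hx
        rw [norm_mul]
        refine (mul_le_mul h1 (hgb R x.2 ((norm_snd_le x).trans hx) j) (norm_nonneg _)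
          (Real.exp_pos _).le).trans (le_of_eq ?_)
        rw [← Real.exp_add]; ring_nf⟩
  obtain ⟨hSs, hSd⟩ := differentiable_tsum_of_gaussian_bound
    (f := fun j (x : ℂ × ℂ) => Complex.exp (c * (j * x.1)) * E (c * (x.1 * (x.2 - j))) *
      Complex.exp (-(x.2 - j) ^ 2)) (fun j => by fun_prop)
    fun R => ⟨R ^ 2 + 2 * Real.pi * R ^ 2, 2 * R + 4 * Real.pi * R, fun x hx j => by
        have hx1 := (norm_fst_le x).trans hx
        have hx2 := (norm_snd_le x).trans hx
        have hR : 0 ≤ R := (norm_nonneg _).trans hx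
        have h1 : ‖Complex.exp (c * (j * x.1))‖ ≤ Real.exp (2 * Real.pi * (|(j : ℝ)| * R)) := by
          refine (Complex.norm_exp_le_exp_norm _).trans (Real.exp_le_exp.mpr ?_)
          rw [norm_mul, hcn, norm_mul, Complex.norm_intCast]
          gcongr
        have h2 : ‖E (c * (x.1 * (x.2 - j)))‖ ≤
            Real.exp (2 * Real.pi * (R * (R + |(j : ℝ)|))) := by
          refine (hEb _).trans (Real.exp_le_exp.mpr ?_)
          rw [norm_mul, hcn, norm_mul]
          gcongr
          exact hsub _ j R hx2
        rw [norm_mul, norm_mul]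
        refine (mul_le_mul (mul_le_mul h1 h2 (norm_nonneg _) (Real.exp_pos _).le)
          (norm_exp_neg_sub_int_sq_le hx2 j) (norm_nonneg _) (by positivity)).trans (le_of_eq ?_)
        rw [← Real.exp_add, ← Real.exp_add]; ring_nf⟩
  refine ⟨_, fun x => x.1 * (∑' j : ℤ, Complex.exp (c * (j * x.1)) *
    E (c * (x.1 * (x.2 - j))) * Complex.exp (-(x.2 - j) ^ 2)) -
      (Complex.exp (c * (x.1 * x.2)) - 1) * r x.2, hAd,
    (differentiable_fst.mul hSd).sub (by fun_prop), fun v w => ?_⟩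
  have hterm : ∀ j : ℤ, (Complex.exp (c * (v * w)) - 1) * g j w =
      (Complex.exp (c * v) - 1) * (p j v * g j w) +
      (Complex.exp (c * w) - 1) * v * (Complex.exp (c * (j * v)) *
        E (c * (v * (w - j))) * Complex.exp (-(w - j) ^ 2)) := fun j => by
    have h1 : Complex.exp (c * (v * w)) =
        Complex.exp (c * (j * v)) * Complex.exp (c * (v * (w - j))) := by
      rw [← Complex.exp_add]; ring_nf
    have h2 : Complex.exp (c * (w - j)) = Complex.exp (c * w) := by
      rw [mul_sub, Complex.exp_sub, hint, div_one]
    have h3 := hE (c * (w - j))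
    have h4 := hE (c * (v * (w - j)))
    rw [h2] at h3
    simp only [g]
    rw [h1]
    linear_combination (Complex.exp (-(w - j) ^ 2) * E (c * (w - j))) * hp j v +
      (Complex.exp (-(w - j) ^ 2) * E (c * (w - j)) * Complex.exp (c * (j * v))) * h4 -
      (v * Complex.exp (c * (j * v)) * E (c * (v * (w - j))) * Complex.exp (-(w - j) ^ 2)) * h3
  have hsum : (Complex.exp (c * (v * w)) - 1) * Θ w =
      (Complex.exp (c * v) - 1) * (∑' j, p j v * g j w) +
      (Complex.exp (c * w) - 1) * v * (∑' j : ℤ, Complex.exp (c * (j * v)) *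
        E (c * (v * (w - j))) * Complex.exp (-(w - j) ^ 2)) := by
    simp only [hΘ]
    rw [← tsum_mul_left, ← tsum_mul_left, ← tsum_mul_left, ← Summable.tsum_add
      ((hAs (v, w)).mul_left _) ((hSs (v, w)).mul_left _)]
    exact tsum_congr hterm
  have hrw := hr w
  linear_combination hsum - (Complex.exp (c * (v * w)) - 1) * hrw

/-- The algebra of entire functions on a complex normed space. -/
def entireFunctions (E : Type*) [NormedAddCommGroup E] [NormedSpace ℂ E] :
    Subalgebra ℂ (E → ℂ) where
  carrier := {f | Differentiable ℂ f}
  mul_mem' := fun hf hg => Differentiable.mul hf hg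
  add_mem' := fun hf hg => Differentiable.add hf hg
  algebraMap_mem' := fun r => differentiable_const r

/-- The entire function `x ↦ exp (a * f x)`. -/
noncomputable def entireExp {E : Type*} [NormedAddCommGroup E] [NormedSpace ℂ E] (a : ℂ)
    (f : entireFunctions E) : entireFunctions E :=
  ⟨fun x => Complex.exp (a * f.1 x), (Differentiable.const_mul f.2 a).cexp⟩

section entireExp

variable {E : Type*} [NormedAddCommGroup E] [NormedSpace ℂ E]

theorem entireExp_add (a : ℂ) (f g : entireFunctions E) :
    entireExp a (f + g) = entireExp a f * entireExp a g := by
  ext x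
  simp [entireExp, mul_add, Complex.exp_add]

theorem entireExp_zero (a : ℂ) : entireExp a (0 : entireFunctions E) = 1 := by
  ext x
  simp [entireExp]

theorem entireExp_pow (a : ℂ) (f : entireFunctions E) (m : ℕ) :
    entireExp a f ^ m = entireExp (m * a) f := by
  ext x
  simp [entireExp, ← Complex.exp_nat_mul, mul_assoc]

theorem entireExp_algebraMap (a b : ℂ) :
    entireExp a (algebraMap ℂ (entireFunctions E) b) = algebraMap ℂ _ (Complex.exp (a * b)) := by
  ext x
  simp [entireExp]

theorem exists_entireExp_mul_sub_one (f g : entireFunctions E) : ∃ A B : entireFunctions E,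
    entireExp (2 * (Real.pi : ℂ) * Complex.I) (f * g) - 1 =
      (entireExp (2 * (Real.pi : ℂ) * Complex.I) f - 1) * A +
      (entireExp (2 * (Real.pi : ℂ) * Complex.I) g - 1) * B := by
  obtain ⟨A, B, hA, hB, h⟩ := exists_entire_exp_mul_sub_one
  have hfg : Differentiable ℂ fun x => (f.1 x, g.1 x) := Differentiable.prodMk f.2 g.2
  refine ⟨⟨fun x => A (f.1 x, g.1 x), hA.comp hfg⟩, ⟨fun x => B (f.1 x, g.1 x), hB.comp hfg⟩, ?_⟩
  ext x
  exact h (f.1 x) (g.1 x)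

end entireExp

/-- If `P` agrees with `Y ^ k` on the part of the spectrum where the `ℓ`-th root of unity `X`
equals `η⁻¹ ^ k`, then `P` is a polynomial in `X` and `Y`. -/
theorem Subalgebra.mem_of_eq_pow_on_roots_of_unity {Q : Type*} [CommRing Q] [Algebra ℂ Q]
    (S : Subalgebra ℂ Q) {ℓ : ℕ} (hℓ : ℓ ≠ 0) {η : ℂ} (hη : IsPrimitiveRoot η ℓ) {X Y P : Q}
    (hX : X ∈ S) (hY : Y ∈ S) (hXℓ : X ^ ℓ = 1) (V A : ℕ → Q) (hP : ∀ k, P = Y ^ k * V k)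
    (hV : ∀ k, V k - 1 = (η ^ k • X - 1) * A k) : P ∈ S := by
  let δ : ℕ → Q := fun k => ∑ i ∈ Finset.range ℓ, (η ^ k • X) ^ i
  have hδS : ∀ k, δ k ∈ S := fun k => S.sum_mem fun i _ => S.pow_mem (S.smul_mem hX _) _
  have hδP : ∀ k, δ k * P = δ k * Y ^ k := fun k => by
    have h1 : δ k * (η ^ k • X - 1) = 0 := by
      simp only [δ]
      rw [geom_sum_mul, smul_pow, hXℓ, ← pow_mul, mul_comm, pow_mul, hη.pow_eq_one, one_pow,
        one_smul, sub_self]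
    rw [hP k]
    linear_combination (Y ^ k * δ k) * hV k + (Y ^ k * A k) * h1
  have hδsum : ∑ k ∈ Finset.range ℓ, δ k = algebraMap ℂ Q ℓ := by
    simp only [δ]
    rw [Finset.sum_comm]
    have h : ∀ i ∈ Finset.range ℓ, ∑ k ∈ Finset.range ℓ, (η ^ k • X) ^ i =
        if i = 0 then algebraMap ℂ Q ℓ else 0 := fun i hi => by
      have hsum : ∑ k ∈ Finset.range ℓ, (η ^ k • X) ^ i =
          (∑ k ∈ Finset.range ℓ, (η ^ i) ^ k) • X ^ i := by
        rw [Finset.sum_smul]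
        exact Finset.sum_congr rfl fun k _ => by
          rw [smul_pow, ← pow_mul, ← pow_mul, mul_comm]
      rw [hsum]
      split_ifs with h0
      · simp [h0, Algebra.smul_def]
      · have hne : η ^ i - 1 ≠ 0 :=
          sub_ne_zero.mpr (hη.pow_ne_one_of_pos_of_lt h0 (Finset.mem_range.mp hi))
        have hz : (∑ k ∈ Finset.range ℓ, (η ^ i) ^ k) * (η ^ i - 1) = 0 := by
          rw [geom_sum_mul, ← pow_mul, mul_comm, pow_mul, hη.pow_eq_one, one_pow, sub_self]
        rw [(mul_eq_zero.mp hz).resolve_right hne, zero_smul]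
    rw [Finset.sum_congr rfl h]
    simp [Nat.pos_of_ne_zero hℓ]
  have hmem : (ℓ : ℂ) • P ∈ S := by
    rw [Algebra.smul_def, ← hδsum, Finset.sum_mul]
    refine S.sum_mem fun k _ => ?_
    rw [hδP k]
    exact S.mul_mem (hδS k) (S.pow_mem hY k)
  have hℓ' : (ℓ : ℂ) ≠ 0 := Nat.cast_ne_zero.mpr hℓ
  have := S.smul_mem hmem (ℓ : ℂ)⁻¹
  rwa [smul_smul, inv_mul_cancel₀ hℓ', one_smul] at this

/-- The entire functions `f` such that, after applying `π`, `exp (2πif)` becomes trivial and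
`exp (2πif/ℓ)` lands in `S`, form a ring. -/
noncomputable def rootExpSubring {E : Type*} [NormedAddCommGroup E] [NormedSpace ℂ E] {Q : Type*}
    [CommRing Q] [Algebra ℂ Q] (π : entireFunctions E →ₐ[ℂ] Q) (S : Subalgebra ℂ Q) (ℓ : ℕ)
    (hℓ : ℓ ≠ 0) : Subring (entireFunctions E) where
  carrier := {f | π (entireExp (2 * (Real.pi : ℂ) * Complex.I / ℓ) f) ∈ S ∧
    π (entireExp (2 * (Real.pi : ℂ) * Complex.I) f) = 1}
  zero_mem' := by simp [entireExp_zero]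
  add_mem' := fun {f g} hf hg => by
    simp only [Set.mem_ofPred_eq, entireExp_add, map_mul]
    exact ⟨S.mul_mem hf.1 hg.1, by rw [hf.2, hg.2, one_mul]⟩
  one_mem' := by
    have h := fun a => entireExp_algebraMap (E := E) a 1
    simp only [map_one, mul_one] at h
    simp only [Set.mem_ofPred_eq, h, AlgHom.commutes, Complex.exp_two_pi_mul_I, map_one, and_true]
    exact S.algebraMap_mem _
  neg_mem' := fun {f} hf => by
    have hinv : ∀ a, π (entireExp a (-f)) * π (entireExp a f) = 1 := fun a => by
      rw [← map_mul, ← entireExp_add, neg_add_cancel, entireExp_zero, map_one]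
    have hpow : π (entireExp (2 * (Real.pi : ℂ) * Complex.I / ℓ) f) ^ ℓ = 1 := by
      rw [← map_pow, entireExp_pow, mul_div_cancel₀ _ (Nat.cast_ne_zero.mpr hℓ), hf.2]
    refine ⟨?_, ?_⟩
    · have h : π (entireExp (2 * (Real.pi : ℂ) * Complex.I / ℓ) (-f)) =
          π (entireExp (2 * (Real.pi : ℂ) * Complex.I / ℓ) f) ^ (ℓ - 1) := by
        obtain ⟨m, rfl⟩ := Nat.exists_eq_succ_of_ne_zero hℓ
        rw [Nat.succ_eq_add_one, Nat.add_sub_cancel, ← mul_one (π _), ← hpow, pow_succ']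
        rw [← mul_assoc, hinv, one_mul]
      rw [h]
      exact S.pow_mem hf.1 _
    · have h := hinv (2 * (Real.pi : ℂ) * Complex.I)
      rwa [hf.2, mul_one] at h
  mul_mem' := fun {f g} hf hg => by
    have hℓ' : (ℓ : ℂ) ≠ 0 := Nat.cast_ne_zero.mpr hℓ
    refine ⟨?_, ?_⟩
    · have hη := (Complex.isPrimitiveRoot_exp ℓ hℓ).inv
      let v : ℕ → entireFunctions E := fun k =>
        (ℓ : ℂ)⁻¹ • (f - algebraMap ℂ (entireFunctions E) k)
      choose A B hAB using fun k => exists_entireExp_mul_sub_one (v k) g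
      refine S.mem_of_eq_pow_on_roots_of_unity hℓ hη hf.1 hg.1 ?_
        (fun k => π (entireExp (2 * (Real.pi : ℂ) * Complex.I) (v k * g))) (fun k => π (A k))
        (fun k => ?_) (fun k => ?_)
      · rw [← map_pow, entireExp_pow, mul_div_cancel₀ _ hℓ', hf.2]
      · rw [← map_pow, ← map_mul]
        congr 1
        ext x
        simp [entireExp, v, ← Complex.exp_nat_mul, ← Complex.exp_add]
        congr 1
        field_simp
        ring
      · have h := congrArg π (hAB k)
        rw [map_sub, map_one, map_add, map_mul, map_mul, map_sub, map_sub, hg.2, map_one, sub_self,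
          zero_mul, add_zero] at h
        rw [h, ← map_smul]
        congr 3
        ext x
        simp [entireExp, v, ← Complex.exp_nat_mul, ← Complex.exp_add, ← Complex.exp_neg]
        congr 1
        field_simp
        ring
    · obtain ⟨A, B, hAB⟩ := exists_entireExp_mul_sub_one f g
      have h := congrArg π hAB
      rw [map_sub, map_one, map_add, map_mul, map_mul, map_sub, map_sub, hf.2, hg.2, map_one,
        sub_self, zero_mul, zero_mul, add_zero] at h
      exact sub_eq_zero.mp h

/-- The algebra generated by finitely many elements of order dividing `ℓ` is spanned by the
monomials with exponents less than `ℓ`. -/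
theorem adjoin_le_span_monomials_of_pow_eq_one {Q ι : Type*} [Fintype ι] [CommRing Q] [Algebra ℂ Q]
    {ℓ : ℕ} (hℓ : ℓ ≠ 0) (x : ι → Q) (hx : ∀ i, x i ^ ℓ = 1) :
    (Algebra.adjoin ℂ (Set.range x)).toSubmodule ≤
      Submodule.span ℂ (Set.range fun k : ι → Fin ℓ => ∏ i, x i ^ (k i : ℕ)) := by
  classical
  have hpow : ∀ m : ι → ℕ, ∃ k : ι → Fin ℓ, ∏ i, x i ^ (k i : ℕ) = ∏ i, x i ^ m i := fun m =>
    ⟨fun i => ⟨m i % ℓ, Nat.mod_lt _ (Nat.pos_of_ne_zero hℓ)⟩,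
      Finset.prod_congr rfl fun i _ => (pow_eq_pow_mod (m i) (hx i)).symm⟩
  rw [Algebra.adjoin_eq_span]
  refine Submodule.span_mono fun y hy => ?_
  induction hy using Submonoid.closure_induction with
  | mem y hy =>
    obtain ⟨j, rfl⟩ := hy
    obtain ⟨k, hk⟩ := hpow (Pi.single j 1)
    refine ⟨k, hk.trans ?_⟩
    rw [Finset.prod_eq_single j (fun i _ hi => by simp [hi]) (by simp)]
    simp
  | one =>
    obtain ⟨k, hk⟩ := hpow 0
    exact ⟨k, hk.trans (by simp)⟩
  | mul y z _ _ hy hz =>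
    obtain ⟨k, rfl⟩ := hy
    obtain ⟨k', rfl⟩ := hz
    obtain ⟨k'', hk⟩ := hpow fun i => k i + k' i
    exact ⟨k'', hk.trans (by simp [pow_add, Finset.prod_mul_distrib])⟩

/-- Reduction of a power-quadratic element to a power-linear element
modulo the lattice ideal: `exp((2πi/ℓ)·q)` equals `exp((2πi/ℓ)·l)` times a Laurent
polynomial in the `exp((2πi/ℓ)·z_i)` (with exponents in `{0,…,ℓ-1}`), modulo the
ideal `I_α` generated by the `z ↦ exp(2πi z_i) - exp(2πi α_i)`. -/
theorem power_quadratic_reduces_to_linear (ℓ n : ℕ) (hℓ : 1 ≤ ℓ) (hn : 1 ≤ n)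
    (c : Fin n → Fin n → ℤ) (α : Fin n → ℂ)
    (q l : (Fin n → ℂ) → ℂ)
    (hq : ∀ z : Fin n → ℂ, q z = ∑ s : Fin n, ∑ t : Fin n, (c s t : ℂ) * z s * z t)
    (hl : ∀ z : Fin n → ℂ, l z = q (α + z) - q α - q z) :
    ∃ (a : (Fin n → Fin ℓ) → ℂ) (ψ : Fin n → ((Fin n → ℂ) → ℂ)),
      (∀ i, Differentiable ℂ (ψ i)) ∧
      ∀ z : Fin n → ℂ,
        Complex.exp ((2 * (Real.pi : ℂ) * Complex.I / (ℓ : ℂ)) * q z) =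
          Complex.exp ((2 * (Real.pi : ℂ) * Complex.I / (ℓ : ℂ)) * l z) *
            (∑ k : Fin n → Fin ℓ, a k *
              Complex.exp ((2 * (Real.pi : ℂ) * Complex.I / (ℓ : ℂ)) *
                ∑ i : Fin n, ((k i : ℕ) : ℂ) * z i)) +
          ∑ i : Fin n,
            (Complex.exp (2 * (Real.pi : ℂ) * Complex.I * z i) -
              Complex.exp (2 * (Real.pi : ℂ) * Complex.I * α i)) * ψ i z := by
  have hℓ0 : ℓ ≠ 0 := Nat.one_le_iff_ne_zero.mp hℓ
  have hℓ' : (ℓ : ℂ) ≠ 0 := Nat.cast_ne_zero.mpr hℓ0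
  set e : ℂ := 2 * (Real.pi : ℂ) * Complex.I with he
  let coord : Fin n → entireFunctions (Fin n → ℂ) := fun i => ⟨fun z => z i, differentiable_apply i⟩
  let gen : Fin n → entireFunctions (Fin n → ℂ) := fun i =>
    entireExp e (coord i) - algebraMap ℂ _ (Complex.exp (e * α i))
  let w : Fin n → entireFunctions (Fin n → ℂ) := fun i => coord i - algebraMap ℂ _ (α i)
  let I := Ideal.span (Set.range gen)
  let π := Ideal.Quotient.mkₐ ℂ I
  let x := fun i => π (entireExp (e / ℓ) (w i))
  have hw : ∀ i, π (entireExp e (w i)) = 1 := fun i => by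
    rw [← sub_eq_zero, ← map_one π, ← map_sub]
    refine Ideal.Quotient.eq_zero_iff_mem.mpr ?_
    have h : entireExp e (w i) - 1 =
        algebraMap ℂ (entireFunctions (Fin n → ℂ)) (Complex.exp (-(e * α i))) * gen i := by
      ext z
      simp [entireExp, w, gen, coord, mul_sub, ← Complex.exp_add, neg_add_eq_sub]
    rw [h]
    exact I.mul_mem_left _ (Ideal.subset_span ⟨i, rfl⟩)
  have hx : ∀ i, x i ^ ℓ = 1 := fun i => by
    simp only [x]
    rw [← map_pow, entireExp_pow, mul_div_cancel₀ _ hℓ', hw]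
  have hwL : ∀ i, w i ∈ rootExpSubring π (Algebra.adjoin ℂ (Set.range x)) ℓ hℓ0 := fun i =>
    ⟨Algebra.subset_adjoin ⟨i, rfl⟩, hw i⟩
  let qw : entireFunctions (Fin n → ℂ) := ∑ s, ∑ t, c s t • (w s * w t)
  have hqw : qw ∈ rootExpSubring π (Algebra.adjoin ℂ (Set.range x)) ℓ hℓ0 :=
    sum_mem fun s _ => sum_mem fun t _ => zsmul_mem (mul_mem (hwL s) (hwL t)) _
  obtain ⟨b, hb⟩ := (Submodule.mem_span_range_iff_exists_fun ℂ).mp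
    (adjoin_le_span_monomials_of_pow_eq_one hℓ0 x hx hqw.1)
  have hmem : entireExp (e / ℓ) qw -
      ∑ k : Fin n → Fin ℓ, b k • ∏ i, entireExp (e / ℓ) (w i) ^ (k i : ℕ) ∈ I := by
    refine Ideal.Quotient.eq_zero_iff_mem.mp ?_
    change π _ = 0
    rw [map_sub, map_sum, sub_eq_zero]
    simpa [x] using hb.symm
  obtain ⟨φ, hφ⟩ := Ideal.mem_span_range_iff_exists_fun.mp hmem
  have hqd : Differentiable ℂ q := by rw [funext hq]; fun_prop
  have hld : Differentiable ℂ l := by rw [funext hl]; fun_prop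
  have hqwz : ∀ z, qw.1 z = q z - l z + q α := fun z => by
    simp only [qw, hl, hq]
    simp [w, coord]
    simp only [← Finset.sum_add_distrib, ← Finset.sum_sub_distrib]
    exact Finset.sum_congr rfl fun s _ => Finset.sum_congr rfl fun t _ => by ring
  refine ⟨fun k => Complex.exp (-(e / ℓ * q α)) * b k *
    Complex.exp (-(e / ℓ * ∑ i, ((k i : ℕ) : ℂ) * α i)),
    fun i z => Complex.exp (e / ℓ * l z) * Complex.exp (-(e / ℓ * q α)) * (φ i).1 z,
    fun i => ?_, fun z => ?_⟩
  · have : Differentiable ℂ (φ i).1 := (φ i).2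
    fun_prop
  · have h : ∑ i, (φ i).1 z * (Complex.exp (e * z i) - Complex.exp (e * α i)) =
        Complex.exp (e / ℓ * qw.1 z) - ∑ k : Fin n → Fin ℓ,
          b k * ∏ i, Complex.exp (e / ℓ * (z i - α i)) ^ (k i : ℕ) := by
      simpa [gen, coord, w, entireExp] using congrFun (congrArg Subtype.val hφ) z
    have hterm : ∀ k : Fin n → Fin ℓ, Complex.exp (-(e / ℓ * q α)) * b k *
        Complex.exp (-(e / ℓ * ∑ i, ((k i : ℕ) : ℂ) * α i)) *
          Complex.exp (e / ℓ * ∑ i, ((k i : ℕ) : ℂ) * z i) =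
        Complex.exp (-(e / ℓ * q α)) *
          (b k * ∏ i, Complex.exp (e / ℓ * (z i - α i)) ^ (k i : ℕ)) := fun k => by
      simp only [← Complex.exp_nat_mul]
      rw [← Complex.exp_sum, mul_assoc, ← Complex.exp_add, mul_assoc, Finset.mul_sum,
        Finset.mul_sum, ← Finset.sum_neg_distrib, ← Finset.sum_add_distrib]
      congr 3
      exact Finset.sum_congr rfl fun i _ => by ring
    have hsplit : Complex.exp (e / ℓ * q z) = Complex.exp (e / ℓ * l z) *
        Complex.exp (-(e / ℓ * q α)) * Complex.exp (e / ℓ * qw.1 z) := by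
      rw [hqwz, ← Complex.exp_add, ← Complex.exp_add]
      ring_nf
    have hψ : ∑ i, (Complex.exp (e * z i) - Complex.exp (e * α i)) *
        (Complex.exp (e / ℓ * l z) * Complex.exp (-(e / ℓ * q α)) * (φ i).1 z) =
        Complex.exp (e / ℓ * l z) * Complex.exp (-(e / ℓ * q α)) *
          ∑ i, (φ i).1 z * (Complex.exp (e * z i) - Complex.exp (e * α i)) := by
      rw [Finset.mul_sum]
      exact Finset.sum_congr rfl fun i _ => by ring
    rw [hψ, h, Finset.sum_congr rfl fun k _ => hterm k, ← Finset.mul_sum, hsplit]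
    ring
end
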